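/- For every n ≥ 1, all measurable functions u_1,…,u_n : E × X → [0,∞], and every measurable F : X → [0,∞], one has ∫ F(ξ) ∏_{k=1}^n (∫ u_k(y,ξ) ξ(dy)) μ(dξ) = ∑_{k=1}^n ∑_{𝒫 = {P_1,…,P_k} ∈ 𝒯_n^k} ∫_X ∫_{E^k} F(ξ+Δ) · ∏_{l=1}^k ∏_{i ∈ P_l} u_i(x_l, ξ+Δ) · ĉ((x_1,…,x_k), ξ) λ(dx_1)⋯λ(dx_k) μ(dξ), where Δ = δ_{x_1} + ⋯ + δ_{x_k}. -/

import Mathlib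

open MeasureTheory Finset

/-- The compound Papangelou intensity along a tuple:
`ĉ((x_1,…,x_k), ξ) = ∏_{l=1}^k c(x_l, ξ + δ_{x_1} + ⋯ + δ_{x_{l−1}})`. -/
noncomputable def chat {E : Type*} [MeasurableSpace E] (c : E → Measure E → ENNReal)
    {k : ℕ} (x : Fin k → E) (ξ : Measure E) : ENNReal :=
  ∏ l : Fin k, c (x l) (ξ + ∑ j ∈ Finset.univ.filter (fun j => j < l), Measure.dirac (x j))

/-- A fixed enumeration of the blocks of a partition of `{1,…,n}`. -/
noncomputable def blockOf {n : ℕ} (P : Finpartition (Finset.univ : Finset (Fin n)))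
    (l : Fin P.parts.card) : Finset (Fin n) := (P.parts.equivFin.symm l : { B // B ∈ P.parts })

namespace Papangelou

section

/-- Amalgamation of countably many sequences of sets. -/
def amalg {E : Type*} (A : ℕ → ℕ → Set E) (n : ℕ) : Set E := A n.unpair.1 n.unpair.2

theorem range_subset_amalg {E : Type*} (A : ℕ → ℕ → Set E) (k : ℕ) :
    Set.range (A k) ⊆ Set.range (amalg A) := by
  rintro _ ⟨i, rfl⟩
  exact ⟨Nat.pair k i, by simp [amalg]⟩

variable {E : Type*} [MeasurableSpace E]

/-- The values of the indicators of the sets `A i` at `x`, and of `ξ` on the sets `A i`. -/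
noncomputable def code (A : ℕ → Set E) (p : E × Measure E) : (ℕ → ENNReal) × (ℕ → ENNReal) :=
  (fun i => (A i).indicator 1 p.1, fun i => p.2 (A i))

/-- The `σ`-algebra on `E × X` of events that depend on countably many evaluations. -/
noncomputable abbrev vis (A : ℕ → Set E) : MeasurableSpace (E × Measure E) :=
  MeasurableSpace.comap (code A) inferInstance

theorem measurable_code {A : ℕ → Set E} (hA : ∀ i, MeasurableSet (A i)) : Measurable (code A) := by
  refine Measurable.prodMk ?_ ?_
  · exact measurable_pi_lambda _ fun i => (measurable_one.indicator (hA i)).comp measurable_fst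
  · exact measurable_pi_lambda _ fun i => (Measure.measurable_coe (hA i)).comp measurable_snd

theorem vis_le {A : ℕ → Set E} (hA : ∀ i, MeasurableSet (A i)) :
    vis A ≤ (inferInstance : MeasurableSpace (E × Measure E)) :=
  (measurable_code hA).comap_le

theorem vis_mono {A A' : ℕ → Set E} (h : Set.range A ⊆ Set.range A') : vis A ≤ vis A' := by
  choose f hf using fun i => h (Set.mem_range_self i)
  have : code A = (fun q : (ℕ → ENNReal) × (ℕ → ENNReal) => (q.1 ∘ f, q.2 ∘ f)) ∘ code A' := by
    funext p
    simp only [code, Function.comp_def, hf]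
  rw [vis, this, ← MeasurableSpace.comap_comp]
  refine MeasurableSpace.comap_mono (Measurable.comap_le ?_)
  refine Measurable.prodMk ?_ ?_
  · exact measurable_pi_lambda _ fun i => (measurable_pi_apply (f i)).comp measurable_fst
  · exact measurable_pi_lambda _ fun i => (measurable_pi_apply (f i)).comp measurable_snd

theorem eq_of_code_eq {A : ℕ → Set E} {W : E × Measure E → ENNReal} (hW : Measurable[vis A] W)
    {p q : E × Measure E} (h : code A p = code A q) : W p = W q := by
  obtain ⟨s, -, hs⟩ := hW (measurableSet_singleton (W q))
  have hq : q ∈ W ⁻¹' {W q} := rfl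
  rw [← hs] at hq
  have hp : p ∈ code A ⁻¹' s := by
    rw [Set.mem_preimage, h]
    exact hq
  rw [hs] at hp
  exact hp

theorem measurableSet_amalg {A : ℕ → ℕ → Set E} (hA : ∀ k i, MeasurableSet (A k i)) (n : ℕ) :
    MeasurableSet (amalg A n) := hA _ _

/-- Events depending on some countable family of evaluations. -/
abbrev visAll : MeasurableSpace (E × Measure E) where
  MeasurableSet' D := ∃ A : ℕ → Set E, (∀ i, MeasurableSet (A i)) ∧ MeasurableSet[vis A] D
  measurableSet_empty := ⟨fun _ => ∅, by simp, @MeasurableSet.empty _ (vis _)⟩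
  measurableSet_compl := fun D ⟨A, hA, hD⟩ => ⟨A, hA, hD.compl⟩
  measurableSet_iUnion := fun f hf => by
    choose A hA hD using hf
    exact ⟨amalg A, measurableSet_amalg hA,
      MeasurableSet.iUnion fun k => vis_mono (range_subset_amalg A k) _ (hD k)⟩

theorem measurable_indicator_vis (A : ℕ → Set E) (i : ℕ) :
    Measurable[vis A] fun p : E × Measure E => (A i).indicator (1 : E → ENNReal) p.1 :=
  ((measurable_pi_apply i).comp measurable_fst).comp (comap_measurable (code A))

theorem measurable_apply_vis (A : ℕ → Set E) (i : ℕ) :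
    Measurable[vis A] fun p : E × Measure E => p.2 (A i) :=
  ((measurable_pi_apply i).comp measurable_snd).comp (comap_measurable (code A))

theorem measurableSet_fst_vis (A : ℕ → Set E) (i : ℕ) :
    MeasurableSet[vis A] {p : E × Measure E | p.1 ∈ A i} := by
  convert measurable_indicator_vis A i (measurableSet_singleton 1) using 1
  ext p
  by_cases h : p.1 ∈ A i <;> simp [h]

theorem le_visAll : (inferInstance : MeasurableSpace (E × Measure E)) ≤ visAll := by
  refine sup_le ?_ ?_
  · rintro _ ⟨s, hs, rfl⟩
    exact ⟨fun _ => s, fun _ => hs, measurableSet_fst_vis (fun _ => s) 0⟩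
  · refine @Measurable.comap_le _ _ visAll _ _ ?_
    refine @Measure.measurable_of_measurable_coe _ _ _ visAll _ fun s hs => ?_
    intro t ht
    exact ⟨fun _ => s, fun _ => hs, measurable_apply_vis (fun _ => s) 0 ht⟩

theorem exists_vis {W : E × Measure E → ENNReal} (hW : Measurable W) :
    ∃ A : ℕ → Set E, (∀ i, MeasurableSet (A i)) ∧ Measurable[vis A] W := by
  refine Measurable.ennreal_induction (motive := fun W : E × Measure E → ENNReal =>
    ∃ A : ℕ → Set E, (∀ i, MeasurableSet (A i)) ∧ Measurable[vis A] W) ?_ ?_ ?_ hW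
  · intro r s hs
    obtain ⟨A, hA, h⟩ := le_visAll s hs
    exact ⟨A, hA, (@measurable_const _ _ _ (vis A) r).indicator h⟩
  · intro f g _ hf hg ihf ihg
    obtain ⟨A, hA, h⟩ := ihf
    obtain ⟨A', hA', h'⟩ := ihg
    refine ⟨amalg (fun n => if n = 0 then A else A'), measurableSet_amalg fun k i => ?_, ?_⟩
    · split_ifs <;> simp [hA, hA']
    · have h1 : Set.range A ⊆ _ := range_subset_amalg (fun n => if n = 0 then A else A') 0
      have h2 : Set.range A' ⊆ _ := range_subset_amalg (fun n => if n = 0 then A else A') 1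
      exact (h.mono (vis_mono h1) le_rfl).add (h'.mono (vis_mono h2) le_rfl)
  · intro f hf _ ih
    choose A hA h using ih
    exact ⟨amalg A, measurableSet_amalg hA, Measurable.iSup fun k =>
      (h k).mono (vis_mono (range_subset_amalg A k)) le_rfl⟩

theorem exists_vis_countable {ι : Type*} [Countable ι] {W : ι → E × Measure E → ENNReal}
    (hW : ∀ j, Measurable (W j)) {A₀ : ℕ → Set E} (hA₀ : ∀ i, MeasurableSet (A₀ i)) :
    ∃ A : ℕ → Set E, (∀ i, MeasurableSet (A i)) ∧ Set.range A₀ ⊆ Set.range A ∧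
      ∀ j, Measurable[vis A] (W j) := by
  choose B hB h using fun j => exists_vis (hW j)
  obtain ⟨φ, hφ⟩ := Countable.exists_injective_nat (Option ι)
  classical
  let G : ℕ → ℕ → Set E := fun n =>
    if hn : ∃ j, φ j = n then (hn.choose).elim A₀ B else A₀
  have hG : ∀ j, G (φ j) = j.elim A₀ B := by
    intro j
    have hn : ∃ j', φ j' = φ j := ⟨j, rfl⟩
    have : hn.choose = j := hφ hn.choose_spec
    simp only [G, dif_pos hn, this]
  refine ⟨amalg G, measurableSet_amalg fun k i => ?_, ?_, fun j => ?_⟩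
  · dsimp only [G]
    split_ifs with hn
    · rcases hn.choose with _ | j
      · exact hA₀ i
      · exact hB j i
    · exact hA₀ i
  · have := range_subset_amalg G (φ none)
    rwa [hG] at this
  · have := range_subset_amalg G (φ (some j))
    rw [hG] at this
    exact (h j).mono (vis_mono this) le_rfl

theorem measurable_of_vis {A : ℕ → Set E} (hA : ∀ i, MeasurableSet (A i))
    {W : E × Measure E → ENNReal} (hW : Measurable[vis A] W) : Measurable W :=
  hW.mono (vis_le hA) le_rfl

end

section

open ProbabilityTheory

variable {E : Type*} [MeasurableSpace E]

/-- Adding the particle `p.1` to the configuration `p.2`. -/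
noncomputable def shift (p : E × Measure E) : E × Measure E := (p.1, p.2 + Measure.dirac p.1)

theorem measurable_add_dirac {α : Type*} [MeasurableSpace α] {f : α → E} {g : α → Measure E}
    (hf : Measurable f) (hg : Measurable g) : Measurable fun a => g a + Measure.dirac (f a) :=
  hg.add (Measure.measurable_dirac.comp hf)

theorem measurable_shift : Measurable (shift (E := E)) :=
  measurable_fst.prodMk (measurable_add_dirac measurable_fst measurable_snd)

/-- Pairs of a particle and a configuration such that the particle lies in a set `A i` (`i` the
first coordinate of `n`) having at most `m` particles (`m` the second coordinate of `n`). -/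
def V (A : ℕ → Set E) (n : ℕ) : Set (E × Measure E) :=
  {p | p.1 ∈ A n.unpair.1 ∧ p.2 (A n.unpair.1) ≤ (n.unpair.2 : ENNReal)}

/-- Pairs of a particle and a configuration such that the particle lies in some `A i` of finite
mass. -/
def U (A : ℕ → Set E) : Set (E × Measure E) := ⋃ n, V A n

theorem mem_U {A : ℕ → Set E} {p : E × Measure E} :
    p ∈ U A ↔ ∃ i, p.1 ∈ A i ∧ p.2 (A i) < ⊤ := by
  simp only [U, V, Set.mem_iUnion, Set.mem_ofPred_eq]
  constructor
  · rintro ⟨n, h1, h2⟩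
    exact ⟨_, h1, h2.trans_lt (ENNReal.natCast_lt_top _)⟩
  · rintro ⟨i, h1, h2⟩
    obtain ⟨m, hm⟩ := ENNReal.exists_nat_gt h2.ne
    exact ⟨Nat.pair i m, by simpa using h1, by simpa using hm.le⟩

theorem U_mono {A A' : ℕ → Set E} (h : Set.range A ⊆ Set.range A') : U A ⊆ U A' := by
  intro p hp
  obtain ⟨i, h1, h2⟩ := mem_U.1 hp
  obtain ⟨j, hj⟩ := h ⟨i, rfl⟩
  exact mem_U.2 ⟨j, hj ▸ h1, hj ▸ h2⟩

theorem measurableSet_V_vis (A : ℕ → Set E) (n : ℕ) : MeasurableSet[vis A] (V A n) :=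
  (measurableSet_fst_vis A _).inter
    (measurable_apply_vis A n.unpair.1 (measurableSet_Iic (a := (n.unpair.2 : ENNReal))))

theorem measurableSet_U_vis (A : ℕ → Set E) : MeasurableSet[vis A] (U A) :=
  MeasurableSet.iUnion fun n => measurableSet_V_vis A n

theorem measurableSet_U {A : ℕ → Set E} (hA : ∀ i, MeasurableSet (A i)) : MeasurableSet (U A) :=
  vis_le hA _ (measurableSet_U_vis A)

theorem measurableSet_V {A : ℕ → Set E} (hA : ∀ i, MeasurableSet (A i)) (n : ℕ) :
    MeasurableSet (V A n) :=
  vis_le hA _ (measurableSet_V_vis A n)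

theorem mem_U_add_dirac {A : ℕ → Set E} (x y : E) (ξ : Measure E) :
    (y, ξ + Measure.dirac x) ∈ U A ↔ (y, ξ) ∈ U A := by
  simp only [mem_U, Measure.coe_add, Pi.add_apply, ENNReal.add_lt_top, measure_lt_top, and_true]

theorem code_add_dirac {A : ℕ → Set E} (hA : ∀ i, MeasurableSet (A i)) {x : E} {ξ : Measure E}
    (h : (x, ξ) ∉ U A) (y : E) : code A (y, ξ + Measure.dirac x) = code A (y, ξ) := by
  simp only [code, Prod.mk.injEq, true_and]
  funext i
  by_cases hx : x ∈ A i
  · have : ξ (A i) = ⊤ := by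
      by_contra h'
      exact h (mem_U.2 ⟨i, hx, lt_top_iff_ne_top.2 h'⟩)
    simp [this]
  · simp [Measure.dirac_apply' _ (hA i), hx]

/-- The section of `D` at the configuration `ξ`. -/
def sec (D : Set (E × Measure E)) (ξ : Measure E) : Set E := {x | (x, ξ) ∈ D}

@[simp]
theorem mem_sec {D : Set (E × Measure E)} {ξ : Measure E} {x : E} : x ∈ sec D ξ ↔ (x, ξ) ∈ D :=
  Iff.rfl

theorem measurable_section {w : E × Measure E → ENNReal} (hw : Measurable w) (ξ : Measure E) :
    Measurable fun x => w (x, ξ) := hw.comp measurable_prodMk_right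

theorem measurable_lintegral_section (lam : Measure E) [SFinite lam] {w : E × Measure E → ENNReal}
    (hw : Measurable w) : Measurable fun ξ => ∫⁻ x, w (x, ξ) ∂lam :=
  (hw.comp measurable_swap).lintegral_prod_right'

theorem measurable_indicator_one {α : Type*} [MeasurableSpace α] {s : Set α}
    (hs : MeasurableSet s) : Measurable (s.indicator (1 : α → ENNReal)) :=
  measurable_one.indicator hs

theorem measurableSet_sec {D : Set (E × Measure E)} (hD : MeasurableSet D) (ξ : Measure E) :
    MeasurableSet (sec D ξ) := measurable_prodMk_right hD

theorem sec_U_add_dirac {A : ℕ → Set E} (x : E) (ξ : Measure E) :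
    sec (U A) (ξ + Measure.dirac x) = sec (U A) ξ := by
  ext y
  exact mem_U_add_dirac x y ξ

/-- The visible part of `ξ`, completed by the intensity on the invisible part. -/
noncomputable def kap (lam : Measure E) (c : E × Measure E → ENNReal) (A : ℕ → Set E)
    (ξ : Measure E) : Measure E :=
  ξ.restrict (sec (U A) ξ) + (lam.restrict (sec (U A) ξ)ᶜ).withDensity fun x => c (x, ξ)

theorem isSFiniteKernel_withDensity {α β : Type*} [MeasurableSpace α] [MeasurableSpace β]
    (κ : Kernel α β) [IsSFiniteKernel κ] {f : α → β → ENNReal}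
    (hf : Measurable (Function.uncurry f)) : IsSFiniteKernel (κ.withDensity f) := by
  let g : ℕ → α → β → ENNReal := fun n a b =>
    (SimpleFunc.eapproxDiff (Function.uncurry f) n (a, b) : NNReal)
  have hg : ∀ n, Measurable (Function.uncurry (g n)) := fun n =>
    (SimpleFunc.measurable _).coe_nnreal_ennreal
  have hfg : f = ∑' n, g n := by
    funext a b
    rw [tsum_apply (Pi.summable.2 fun _ => Pi.summable.2 fun _ => ENNReal.summable),
      tsum_apply (Pi.summable.2 fun _ => ENNReal.summable)]
    exact (SimpleFunc.tsum_eapproxDiff _ hf (a, b)).symm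
  rw [hfg, Kernel.withDensity_tsum κ hg]
  have : ∀ n, IsSFiniteKernel (κ.withDensity (g n)) := fun n =>
    Kernel.IsSFiniteKernel.withDensity κ (f := g n) fun _ _ => ENNReal.coe_ne_top
  infer_instance

theorem exists_kernel_restrict_U {A : ℕ → Set E} (hA : ∀ i, MeasurableSet (A i)) :
    ∃ κ : Kernel (Measure E) E, IsSFiniteKernel κ ∧ ∀ ξ, κ ξ = ξ.restrict (sec (U A) ξ) := by
  classical
  let η : ℕ → Kernel (Measure E) E := fun n =>
    { toFun := fun ξ => if ξ (A n.unpair.1) ≤ (n.unpair.2 : ENNReal) then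
        ξ.restrict (A n.unpair.1) else 0
      measurable' := Measurable.ite
        (Measure.measurable_coe (hA _) measurableSet_Iic)
        (by
          refine Measure.measurable_of_measurable_coe _ fun s hs => ?_
          simp_rw [Measure.restrict_apply hs]
          exact Measure.measurable_coe (hs.inter (hA _))) measurable_const }
  have hη : ∀ n ξ, η n ξ = if ξ (A n.unpair.1) ≤ (n.unpair.2 : ENNReal) then
        ξ.restrict (A n.unpair.1) else 0 := fun n ξ => rfl
  have hfin : ∀ n, IsFiniteKernel (η n) := fun n => ⟨(n.unpair.2 : ENNReal),
    ENNReal.natCast_lt_top _, fun ξ => by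
      rw [hη]
      split_ifs with h
      · simpa using h
      · simp⟩
  let D : ℕ → Set (E × Measure E) := disjointed (V A)
  have hD : ∀ n, MeasurableSet (D n) := fun n =>
    MeasurableSet.disjointed (fun k => measurableSet_V hA k) n
  let f : ℕ → Measure E → E → ENNReal := fun n ξ x => (D n).indicator 1 (x, ξ)
  have hf : ∀ n, Measurable (Function.uncurry (f n)) := fun n =>
    (measurable_one.indicator (hD n)).comp measurable_swap
  refine ⟨Kernel.sum fun n => (η n).withDensity (f n), ?_, fun ξ => ?_⟩
  · have := fun n => isSFiniteKernel_withDensity (η n) (hf n)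
    infer_instance
  · rw [Kernel.sum_apply]
    have key : ∀ n, (η n).withDensity (f n) ξ = ξ.restrict (sec (D n) ξ) := by
      intro n
      rw [Kernel.withDensity_apply _ (hf n)]
      have : f n ξ = (sec (D n) ξ).indicator 1 := by
        funext x
        simp [f, sec, Set.indicator_apply]
      rw [this, withDensity_indicator_one (measurableSet_sec (hD n) ξ), hη]
      have hsub : D n ⊆ V A n := disjointed_subset _ _
      split_ifs with h
      · rw [Measure.restrict_restrict (measurableSet_sec (hD n) ξ)]
        congr 1
        exact Set.inter_eq_left.2 fun x hx => (hsub hx).1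
      · have : sec (D n) ξ = ∅ := by
          ext x
          simp only [Set.mem_empty_iff_false, iff_false]
          exact fun hx => h (hsub hx).2
        simp [this]
    simp_rw [key]
    rw [← Measure.restrict_iUnion]
    · congr 1
      ext x
      have : U A = ⋃ n, D n := iUnion_disjointed.symm
      simp [sec, this]
    · intro i j hij
      exact Set.disjoint_left.2 fun x hx hx' =>
        Set.disjoint_left.1 (disjoint_disjointed _ hij) hx hx'
    · exact fun n => measurableSet_sec (hD n) ξ

section kap

variable {c : E × Measure E → ENNReal} {A : ℕ → Set E}

theorem exists_kernel_kap (lam : Measure E) [SigmaFinite lam] (hc : Measurable c)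
    (hA : ∀ i, MeasurableSet (A i)) :
    ∃ κ : Kernel (Measure E) E, IsSFiniteKernel κ ∧ ∀ ξ, κ ξ = kap lam c A ξ := by
  obtain ⟨κ, hκ, h⟩ := exists_kernel_restrict_U hA
  have hm : Measurable (Function.uncurry fun (ξ : Measure E) x => (U A)ᶜ.indicator c (x, ξ)) :=
    (hc.indicator (measurableSet_U hA).compl).comp measurable_swap
  have := isSFiniteKernel_withDensity (Kernel.const (Measure E) lam) hm
  refine ⟨κ + (Kernel.const _ lam).withDensity
    fun ξ x => (U A)ᶜ.indicator c (x, ξ), inferInstance, fun ξ => ?_⟩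
  rw [FunLike.coe_add, Pi.add_apply, h, Kernel.withDensity_apply _ hm, kap, Kernel.const_apply]
  congr 1
  rw [← withDensity_indicator (measurableSet_sec (measurableSet_U hA) ξ).compl]
  congr 1

theorem measurable_lintegral_kap (lam : Measure E) [SigmaFinite lam] (hc : Measurable c)
    (hA : ∀ i, MeasurableSet (A i)) {α : Type*} [MeasurableSpace α] {g : α → Measure E}
    (hg : Measurable g) {f : α × E → ENNReal} (hf : Measurable f) :
    Measurable fun a => ∫⁻ x, f (a, x) ∂(kap lam c A (g a)) := by
  obtain ⟨κ, hκ, h⟩ := exists_kernel_kap lam hc hA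
  have := hf.lintegral_kernel_prod_right' (κ := κ.comap g hg)
  simpa only [Kernel.comap_apply, h] using this

theorem sFinite_kap (lam : Measure E) [SigmaFinite lam] (hc : Measurable c)
    (hA : ∀ i, MeasurableSet (A i)) (ξ : Measure E) : SFinite (kap lam c A ξ) := by
  obtain ⟨κ, hκ, h⟩ := exists_kernel_kap lam hc hA
  rw [← h]
  infer_instance

theorem lintegral_kap {lam : Measure E} {c : E × Measure E → ENNReal} {A : ℕ → Set E}
    (hc : Measurable c) (ξ : Measure E)
    {w : E → ENNReal} (hw : Measurable w) :
    ∫⁻ x, w x ∂(kap lam c A ξ) =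
      ∫⁻ x in sec (U A) ξ, w x ∂ξ + ∫⁻ x in (sec (U A) ξ)ᶜ, w x * c (x, ξ) ∂lam := by
  have hcx : Measurable fun x => c (x, ξ) := hc.comp measurable_prodMk_right
  rw [kap, lintegral_add_measure, lintegral_withDensity_eq_lintegral_mul _
    hcx hw]
  simp only [Pi.mul_apply, mul_comm]

theorem kap_apply {lam : Measure E} {c : E × Measure E → ENNReal} {A : ℕ → Set E} (ξ : Measure E)
    {Q : Set E} (hQ : MeasurableSet Q) :
    kap lam c A ξ Q = ξ (Q ∩ sec (U A) ξ) + ∫⁻ x in Q ∩ (sec (U A) ξ)ᶜ, c (x, ξ) ∂lam := by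
  rw [kap, Measure.add_apply, Measure.restrict_apply hQ, withDensity_apply _ hQ,
    Measure.restrict_restrict hQ]

end kap

end

section

open ProbabilityTheory

variable {E : Type*} [MeasurableSpace E]

/-- The Georgii–Nguyen–Zessin identity. -/
def GNZ (lam : Measure E) (μ : Measure (Measure E)) (c : E × Measure E → ENNReal) : Prop :=
  ∀ w : E × Measure E → ENNReal, Measurable w →
    ∫⁻ ξ, ∫⁻ x, w (x, ξ) ∂ξ ∂μ = ∫⁻ ξ, ∫⁻ x, w (x, ξ + Measure.dirac x) * c (x, ξ) ∂lam ∂μ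

/-- A sequence of measurable sets such that enlarging it does not make visible any further
particles. -/
structure IsMax (lam : Measure E) (μ : Measure (Measure E)) (c : E × Measure E → ENNReal)
    (A : ℕ → Set E) : Prop where
  meas : ∀ i, MeasurableSet (A i)
  vis_c : Measurable[vis A] c
  null : ∀ A' : ℕ → Set E, (∀ i, MeasurableSet (A' i)) → Set.range A ⊆ Set.range A' →
    ∀ᵐ ξ ∂μ, ∀ᵐ x ∂lam, (x, ξ) ∈ U A' → (x, ξ) ∉ U A → c (x, ξ) = 0

theorem exists_isMax (lam : Measure E) [SigmaFinite lam] (μ : Measure (Measure E))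
    [IsProbabilityMeasure μ] {c : E × Measure E → ENNReal} (hc : Measurable c) :
    ∃ A, IsMax lam μ c A := by
  have hcs : Measurable fun q : Measure E × E => c (q.2, q.1) := hc.comp measurable_swap
  let ν₀ : Measure (Measure E × E) := (μ.prod lam).withDensity fun q => c (q.2, q.1)
  let ν := ν₀.toFinite
  obtain ⟨A₁, hA₁, hcA₁⟩ := exists_vis hc
  let S : Set ENNReal := {t | ∃ A : ℕ → Set E, (∀ i, MeasurableSet (A i)) ∧
    t = ν (Prod.swap ⁻¹' U A)}
  obtain ⟨t, -, ht, htS⟩ := exists_seq_tendsto_sSup (S := S) ⟨_, A₁, hA₁, rfl⟩ (OrderTop.bddAbove S)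
  choose B hB hBt using htS
  let G : ℕ → ℕ → Set E := fun n => Nat.casesOn n A₁ B
  have hG : ∀ k i, MeasurableSet (G k i) := by
    rintro (_ | k) i
    · exact hA₁ i
    · exact hB k i
  have hsup : sSup S ≤ ν (Prod.swap ⁻¹' U (amalg G)) := by
    refine le_of_tendsto' ht fun n => ?_
    rw [hBt n]
    exact measure_mono (Set.preimage_mono (U_mono (range_subset_amalg G (n + 1))))
  refine ⟨amalg G, measurableSet_amalg hG, hcA₁.mono (vis_mono (range_subset_amalg G 0)) le_rfl,
    fun A' hA' h => ?_⟩
  have hm := measurableSet_U (measurableSet_amalg hG)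
  have hm' := measurableSet_U hA'
  have h1 : ν (Prod.swap ⁻¹' (U A' \ U (amalg G))) = 0 := by
    rw [Set.preimage_sdiff, measure_sdiff (Set.preimage_mono (U_mono h))
      (measurable_swap hm).nullMeasurableSet (measure_ne_top _ _)]
    exact tsub_eq_zero_of_le ((le_sSup ⟨A', hA', rfl⟩ : _ ≤ sSup S).trans hsup)
  have h2 : ν₀ (Prod.swap ⁻¹' (U A' \ U (amalg G))) = 0 := absolutelyContinuous_toFinite ν₀ h1
  have hmm : MeasurableSet (Prod.swap ⁻¹' (U A' \ U (amalg G))) := measurable_swap (hm'.diff hm)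
  rw [withDensity_apply _ hmm, setLIntegral_eq_zero_iff hmm hcs] at h2
  filter_upwards [Measure.ae_ae_of_ae_prod h2] with ξ hξ
  filter_upwards [hξ] with x hx h h'
  exact hx ⟨h, h'⟩

variable {lam : Measure E} {μ : Measure (Measure E)} {c : E × Measure E → ENNReal} {A : ℕ → Set E}

theorem ae_add_dirac (hc : Measurable c) [SigmaFinite lam] (hG : GNZ lam μ c)
    {P : Measure E → Prop} (hP : ∀ᵐ ξ ∂μ, P ξ) :
    ∀ᵐ ξ ∂μ, ∀ᵐ x ∂lam, c (x, ξ) ≠ 0 → P (ξ + Measure.dirac x) := by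
  let N := toMeasurable μ {ξ | ¬ P ξ}
  have hN : MeasurableSet N := measurableSet_toMeasurable _ _
  have hN0 : μ N = 0 := by rw [measure_toMeasurable]; exact hP
  have hw : Measurable fun p : E × Measure E => N.indicator (1 : Measure E → ENNReal) p.2 :=
    (measurable_one.indicator hN).comp measurable_snd
  have h := hG _ hw
  have h0 : ∫⁻ ξ, ∫⁻ x, N.indicator (1 : Measure E → ENNReal) ξ ∂ξ ∂μ = 0 := by
    rw [lintegral_eq_zero_of_ae_eq_zero]
    filter_upwards [measure_eq_zero_iff_ae_notMem.1 hN0] with ξ hξ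
    simp [hξ]
  simp only [h0] at h
  have hm : Measurable fun q : Measure E × E =>
      N.indicator (1 : Measure E → ENNReal) (q.1 + Measure.dirac q.2) * c (q.2, q.1) :=
    ((measurable_one.indicator hN).comp (measurable_add_dirac measurable_snd measurable_fst)).mul
      (hc.comp measurable_swap)
  have h2 := (lintegral_eq_zero_iff hm.lintegral_prod_right').1 h.symm
  filter_upwards [h2] with ξ hξ
  have := (lintegral_eq_zero_iff (hm.comp measurable_prodMk_left)).1 hξ
  filter_upwards [this] with x hx hcx
  by_contra hcon
  have : ξ + Measure.dirac x ∈ N := subset_toMeasurable _ _ hcon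
  simp [this, hcx] at hx

theorem lintegral_kap_of_vis [SigmaFinite lam] [SFinite μ] (hc : Measurable c) (hG : GNZ lam μ c)
    (hA : ∀ i, MeasurableSet (A i)) {w : E × Measure E → ENNReal} (hw : Measurable[vis A] w) :
    ∫⁻ ξ, ∫⁻ x, w (x, ξ) ∂(kap lam c A ξ) ∂μ =
      ∫⁻ ξ, ∫⁻ x, w (x, ξ + Measure.dirac x) * c (x, ξ) ∂lam ∂μ := by
  have hwm := measurable_of_vis hA hw
  have hU := measurableSet_U hA
  have e1 : ∀ ξ, ∫⁻ x, w (x, ξ) ∂(kap lam c A ξ) = ∫⁻ x, (U A).indicator w (x, ξ) ∂ξ +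
      ∫⁻ x, (U A)ᶜ.indicator (fun p => w (shift p) * c p) (x, ξ) ∂lam := by
    intro ξ
    rw [lintegral_kap hc ξ (measurable_section hwm ξ),
      ← lintegral_indicator (measurableSet_sec hU ξ),
      ← lintegral_indicator (measurableSet_sec hU ξ).compl]
    congr 1
    refine lintegral_congr fun x => ?_
    by_cases hx : (x, ξ) ∈ U A
    · simp [hx]
    · have : w (shift (x, ξ)) = w (x, ξ) := eq_of_code_eq hw (code_add_dirac hA hx x)
      simp [sec, hx, this]
  have hm2 : Measurable ((U A)ᶜ.indicator fun p => w (shift p) * c p) :=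
    ((hwm.comp measurable_shift).mul hc).indicator hU.compl
  simp_rw [e1]
  rw [lintegral_add_right _ (measurable_lintegral_section lam hm2),
    hG _ (hwm.indicator hU)]
  have hm1 : Measurable fun p : E × Measure E =>
      (U A).indicator w (p.1, p.2 + Measure.dirac p.1) * c p :=
    (((hwm.indicator hU).comp measurable_shift).mul hc)
  rw [← lintegral_add_right _ (measurable_lintegral_section lam hm2)]
  refine lintegral_congr fun ξ => ?_
  rw [← lintegral_add_right _ (measurable_section hm2 ξ)]
  refine lintegral_congr fun x => ?_
  by_cases hx : (x, ξ) ∈ U A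
  · simp [hx, mem_U_add_dirac]
  · simp [hx, mem_U_add_dirac, shift]

theorem kap_ae_eq [SigmaFinite lam] [SFinite μ] (hG : GNZ lam μ c)
    (hA : IsMax lam μ c A) {A' : ℕ → Set E}
    (hA' : ∀ i, MeasurableSet (A' i)) (h : Set.range A ⊆ Set.range A') :
    ∀ᵐ ξ ∂μ, kap lam c A' ξ = kap lam c A ξ ∧ ξ (sec (U A') ξ \ sec (U A) ξ) = 0 := by
  have hU := measurableSet_U hA.meas
  have hU' := measurableSet_U hA'
  have hD : MeasurableSet (U A' \ U A) := hU'.diff hU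
  have h0 : ∫⁻ ξ, ξ (sec (U A') ξ \ sec (U A) ξ) ∂μ = 0 := by
    have := hG _ (measurable_one.indicator hD : Measurable ((U A' \ U A).indicator 1))
    have e : ∀ ξ : Measure E, ∫⁻ x, (U A' \ U A).indicator (1 : E × Measure E → ENNReal) (x, ξ) ∂ξ
        = ξ (sec (U A') ξ \ sec (U A) ξ) := by
      intro ξ
      rw [← lintegral_indicator_one ((measurableSet_sec hU' ξ).diff (measurableSet_sec hU ξ))]
      rfl
    simp_rw [e] at this
    rw [this]
    refine lintegral_eq_zero_of_ae_eq_zero ?_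
    filter_upwards [hA.null A' hA' h] with ξ hξ
    refine lintegral_eq_zero_of_ae_eq_zero ?_
    filter_upwards [hξ] with x hx
    by_cases hx1 : (x, ξ) ∈ U A' \ U A
    · simp [hx hx1.1 hx1.2]
    · have : (x, ξ + Measure.dirac x) ∉ U A' \ U A := by
        simpa only [Set.mem_sdiff, mem_U_add_dirac] using hx1
      simp [this]
  have hmeas : Measurable fun ξ : Measure E => ξ (sec (U A') ξ \ sec (U A) ξ) := by
    obtain ⟨κ, hκ, hκ'⟩ := exists_kernel_restrict_U hA'
    have := Kernel.measurable_kernel_prodMk_left (κ := κ) (measurable_swap hD)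
    convert this using 2 with ξ
    rw [hκ', Measure.restrict_apply (measurable_prodMk_left (measurable_swap hD))]
    congr 1
    ext x
    simp [and_comm]
  filter_upwards [(lintegral_eq_zero_iff hmeas).1 h0, hA.null A' hA' h] with ξ hξ hξ2
  refine ⟨?_, hξ⟩
  have hs : sec (U A) ξ ⊆ sec (U A') ξ := fun x hx => U_mono h hx
  have hm := measurableSet_sec hU ξ
  have hm' := measurableSet_sec hU' ξ
  unfold kap
  congr 1
  · refine Measure.restrict_congr_set (Filter.EventuallyLE.antisymm ?_ hs.eventuallyLE)
    rw [ae_le_set]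
    exact hξ
  · ext Q hQ
    rw [withDensity_apply _ hQ, withDensity_apply _ hQ, Measure.restrict_restrict hQ,
      Measure.restrict_restrict hQ, ← lintegral_indicator (hQ.inter hm'.compl),
      ← lintegral_indicator (hQ.inter hm.compl)]
    refine lintegral_congr_ae ?_
    filter_upwards [hξ2] with x hx
    have hx' : x ∉ sec (U A) ξ → x ∈ sec (U A') ξ → c (x, ξ) = 0 := fun h1 h2 => hx h2 h1
    have hs' := @hs x
    classical
    by_cases h0 : x ∈ Q <;> by_cases h1 : x ∈ sec (U A) ξ <;> by_cases h2 : x ∈ sec (U A') ξ <;>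
      simp only [Set.indicator_apply, Set.mem_inter_iff, Set.mem_compl_iff, h0, h1, h2] <;>
      simp_all

theorem exists_vis_kap {ι : Type*} [Countable ι] [SigmaFinite lam] [SFinite μ]
    (hG : GNZ lam μ c) (hA : IsMax lam μ c A) {W : ι → E × Measure E → ENNReal}
    (hW : ∀ j, Measurable (W j)) :
    ∃ A' : ℕ → Set E, (∀ i, MeasurableSet (A' i)) ∧ Set.range A ⊆ Set.range A' ∧
      (∀ j, Measurable[vis A'] (W j)) ∧
      ∀ᵐ ξ ∂μ, kap lam c A' ξ = kap lam c A ξ ∧ ξ (sec (U A') ξ \ sec (U A) ξ) = 0 := by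
  obtain ⟨A', h1, h2, h3⟩ := exists_vis_countable hW hA.meas
  exact ⟨A', h1, h2, h3, kap_ae_eq hG hA h1 h2⟩

/-- The GNZ identity for the regularised configuration `kap`. -/
theorem gnz_kap [SigmaFinite lam] [SFinite μ] (hc : Measurable c) (hG : GNZ lam μ c)
    (hA : IsMax lam μ c A) {w : E × Measure E → ENNReal} (hw : Measurable w) :
    ∫⁻ ξ, ∫⁻ x, w (x, ξ) ∂(kap lam c A ξ) ∂μ =
      ∫⁻ ξ, ∫⁻ x, w (x, ξ + Measure.dirac x) * c (x, ξ) ∂lam ∂μ := by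
  obtain ⟨A', h1, h2, h3, h4⟩ := exists_vis_kap hG hA (fun _ : Unit => hw)
  rw [← lintegral_kap_of_vis hc hG h1 (h3 ())]
  refine lintegral_congr_ae ?_
  filter_upwards [h4] with ξ hξ
  rw [hξ.1]

theorem lintegral_eq_kap [SigmaFinite lam] [SFinite μ] (hc : Measurable c) (hG : GNZ lam μ c)
    (hA : IsMax lam μ c A) {w : E × Measure E → ENNReal} (hw : Measurable w) :
    ∫⁻ ξ, ∫⁻ x, w (x, ξ) ∂ξ ∂μ = ∫⁻ ξ, ∫⁻ x, w (x, ξ) ∂(kap lam c A ξ) ∂μ := by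
  rw [gnz_kap hc hG hA hw, hG _ hw]

theorem measurable_kap_apply (lam : Measure E) [SigmaFinite lam] (hc : Measurable c)
    (hA : ∀ i, MeasurableSet (A i)) {D : Set (E × Measure E)} (hD : MeasurableSet D) :
    Measurable fun ξ => kap lam c A ξ (sec D ξ) := by
  have e : ∀ ξ, kap lam c A ξ (sec D ξ) =
      ∫⁻ x, D.indicator (1 : E × Measure E → ENNReal) (x, ξ) ∂(kap lam c A ξ) := by
    intro ξ
    rw [← lintegral_indicator_one (measurableSet_sec hD ξ)]
    rfl
  simp_rw [e]
  exact measurable_lintegral_kap lam hc hA measurable_id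
    ((measurable_indicator_one hD).comp measurable_swap)

theorem kap_apply_ae [SigmaFinite lam] [IsProbabilityMeasure μ] (hc : Measurable c)
    (hG : GNZ lam μ c) (hA : IsMax lam μ c A) {Q : Set E} (hQ : MeasurableSet Q) :
    ∀ᵐ ξ ∂μ, kap lam c A ξ Q = ξ Q := by
  have hQ' : MeasurableSet {p : E × Measure E | p.1 ∈ Q} := measurable_fst hQ
  have hκ : Measurable fun ξ => kap lam c A ξ Q := by
    have h1 := measurable_kap_apply lam hc hA.meas hQ'
    have h2 : ∀ ξ, sec {p : E × Measure E | p.1 ∈ Q} ξ = Q := fun ξ => by ext x; simp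
    simpa only [h2] using h1
  refine ae_eq_of_forall_setLIntegral_eq_of_sigmaFinite
    hκ (Measure.measurable_coe hQ) fun B hB _ => ?_
  have hm : Measurable fun p : E × Measure E =>
      (B.indicator (1 : Measure E → ENNReal) p.2) * Q.indicator (1 : E → ENNReal) p.1 :=
    ((measurable_one.indicator hB).comp measurable_snd).mul
      ((measurable_one.indicator hQ).comp measurable_fst)
  have := lintegral_eq_kap hc hG hA hm
  have e : ∀ (m : Measure E → Measure E) (ξ : Measure E),
      ∫⁻ x, B.indicator (1 : Measure E → ENNReal) ξ * Q.indicator (1 : E → ENNReal) x ∂(m ξ) =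
        B.indicator (fun ξ => m ξ Q) ξ := by
    intro m ξ
    rw [lintegral_const_mul _ (measurable_one.indicator hQ), lintegral_indicator_one hQ]
    by_cases h : ξ ∈ B <;> simp [h]
  rw [← lintegral_indicator hB, ← lintegral_indicator hB, ← lintegral_congr (e (kap lam c A)),
    ← lintegral_congr (e fun ξ => ξ)]
  exact this.symm

end

section

open ProbabilityTheory

variable {E : Type*} [MeasurableSpace E]
variable {lam : Measure E} {μ : Measure (Measure E)} {c : E × Measure E → ENNReal} {A : ℕ → Set E}

/-- Although `ξ ↦ ∫ w(x, ξ) ξ(dx)` need not be measurable, it has a measurable minorant with the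
same integrals, which is given by `kap`. -/
theorem exists_minorant [SigmaFinite lam] [IsProbabilityMeasure μ] (hc : Measurable c)
    (hG : GNZ lam μ c) (hA : IsMax lam μ c A) {w : E × Measure E → ENNReal} (hw : Measurable w) :
    ∃ g : Measure E → ENNReal, Measurable g ∧ (∀ ξ, g ξ ≤ ∫⁻ x, w (x, ξ) ∂ξ) ∧
      ∀ᵐ ξ ∂μ, g ξ = ∫⁻ x, w (x, ξ) ∂(kap lam c A ξ) := by
  obtain ⟨g, hg, hle, hint⟩ := exists_measurable_le_forall_setLIntegral_eq μ
    (fun ξ : Measure E => ∫⁻ x, w (x, ξ) ∂ξ)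
  refine ⟨g, hg, hle, ?_⟩
  have hκ : Measurable fun ξ => ∫⁻ x, w (x, ξ) ∂(kap lam c A ξ) :=
    measurable_lintegral_kap lam hc hA.meas measurable_id (hw.comp measurable_swap)
  refine ae_eq_of_forall_setLIntegral_eq_of_sigmaFinite hg hκ fun B hB _ => ?_
  rw [← hint B, ← lintegral_indicator hB, ← lintegral_indicator hB]
  have hm : Measurable ((Prod.snd ⁻¹' B).indicator w) := hw.indicator (measurable_snd hB)
  have e : ∀ (m : Measure E → Measure E) (ξ : Measure E),
      ∫⁻ x, (Prod.snd ⁻¹' B).indicator w (x, ξ) ∂(m ξ) =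
        B.indicator (fun ξ => ∫⁻ x, w (x, ξ) ∂(m ξ)) ξ := by
    intro m ξ
    by_cases h : ξ ∈ B <;> simp [h]
  rw [← lintegral_congr (e (kap lam c A)), ← lintegral_congr (e fun ξ => ξ)]
  exact lintegral_eq_kap hc hG hA hm

/-- Rigidity of the invisible part: mass in a set `S` of invisible points is only possible if
`S` contains all invisible points of one of countably many deterministic sets. -/
theorem exists_forced [SigmaFinite lam] [IsProbabilityMeasure μ] (hc : Measurable c)
    (hG : GNZ lam μ c) (hA : IsMax lam μ c A) {S : Set (E × Measure E)} (hS : MeasurableSet S)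
    (hSU : Disjoint S (U A)) :
    ∃ Q : ℕ → Set E, (∀ i, MeasurableSet (Q i)) ∧ ∀ᵐ ξ ∂μ, kap lam c A ξ (sec S ξ) ≠ 0 →
      ∃ i, kap lam c A ξ ((Q i \ sec (U A) ξ) \ sec S ξ) = 0 ∧
        kap lam c A ξ (Q i \ sec (U A) ξ) = ⊤ := by
  obtain ⟨g, hg, hle, hgκ⟩ := exists_minorant hc hG hA (measurable_indicator_one hS)
  obtain ⟨A', hA', hAA', hvis, hκ'⟩ := exists_vis_kap hG hA
    (W := fun b : Bool => if b then S.indicator (1 : E × Measure E → ENNReal) else fun p => g p.2)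
    (by rintro (_ | _)
        · exact hg.comp measurable_snd
        · exact measurable_indicator_one hS)
  have hSvis : Measurable[vis A'] (S.indicator (1 : E × Measure E → ENNReal)) := by
    simpa using hvis true
  have hgvis : Measurable[vis A'] (fun p : E × Measure E => g p.2) := by simpa using hvis false
  have hU := measurableSet_U hA.meas
  have hU' := measurableSet_U hA'
  have hUU : U A ⊆ U A' := U_mono hAA'
  have hall : ∀ᵐ ξ ∂μ, ∀ i, kap lam c A ξ (A' i) = ξ (A' i) :=
    ae_all_iff.2 fun i => kap_apply_ae hc hG hA (hA' i)
  refine ⟨A', hA', ?_⟩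
  filter_upwards [hgκ, hκ', hall] with ξ h1 h2 h3 hpos
  obtain ⟨h2, h2'⟩ := h2
  have hsec := measurableSet_sec hU ξ
  have hsec' := measurableSet_sec hU' ξ
  have hsecS := measurableSet_sec hS ξ
  have ind : ∀ (m ξ : Measure E), ∫⁻ x, S.indicator (1 : E × Measure E → ENNReal) (x, ξ) ∂m =
      m (sec S ξ) := by
    intro m ξ
    rw [← lintegral_indicator_one (measurableSet_sec hS ξ)]
    rfl
  rw [ind] at h1
  simp only [ind] at hle
  by_contra hcon
  push Not at hcon
  let good : ℕ → Prop := fun i => ξ (A' i) = ⊤ ∧ ξ (A' i ∩ sec (U A') ξ) < ⊤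
  have hgood : ∀ i, good i → ∃ y, y ∈ A' i ∧ (y, ξ) ∉ U A' ∧ (y, ξ) ∉ S := by
    rintro i ⟨hi1, hi2⟩
    have e1 : kap lam c A ξ (A' i \ sec (U A') ξ) = ⊤ := by
      have hsplit : kap lam c A ξ (A' i) = kap lam c A ξ (A' i ∩ sec (U A') ξ) +
          kap lam c A ξ (A' i \ sec (U A') ξ) := (measure_inter_add_sdiff _ hsec').symm
      have e2 : kap lam c A ξ (A' i ∩ sec (U A') ξ) = ξ (A' i ∩ sec (U A') ξ) := by
        rw [← h2, kap_apply ξ ((hA' i).inter hsec')]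
        simp [Set.inter_assoc]
      rw [h3 i, hi1, e2] at hsplit
      by_contra hne
      exact absurd hsplit.symm (ENNReal.add_ne_top.2 ⟨hi2.ne, hne⟩)
    have e3 : kap lam c A ξ (A' i \ sec (U A) ξ) = ⊤ :=
      top_unique (e1 ▸ measure_mono (Set.sdiff_subset_sdiff_right fun x hx => hUU hx))
    have e4 : kap lam c A ξ ((A' i \ sec (U A) ξ) \ sec S ξ) ≠ 0 := fun h0 => hcon i h0 e3
    have e5 : kap lam c A ξ (sec (U A') ξ \ sec (U A) ξ) = 0 := by
      rw [← h2, kap_apply ξ (hsec'.diff hsec)]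
      have i1 : (sec (U A') ξ \ sec (U A) ξ) ∩ sec (U A') ξ = sec (U A') ξ \ sec (U A) ξ := by
        ext x; simp; tauto
      have i2 : (sec (U A') ξ \ sec (U A) ξ) ∩ (sec (U A') ξ)ᶜ = ∅ := by
        ext x; simp; tauto
      simp [i1, i2, h2']
    by_contra hno
    push Not at hno
    refine e4 (measure_mono_null ?_ e5)
    rintro x ⟨⟨hx1, hx2⟩, hx3⟩
    refine ⟨?_, hx2⟩
    by_contra hx4
    exact hx3 (hno x hx1 hx4)
  have hne : (sec S ξ).Nonempty := nonempty_of_measure_ne_zero hpos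
  obtain ⟨x₀, hx₀⟩ := hne
  have : Nonempty E := ⟨x₀⟩
  classical
  choose! y hy using hgood
  let ξ' : Measure E := ξ.restrict (sec (U A') ξ) +
    Measure.sum fun i => if good i then (⊤ : ENNReal) • Measure.dirac (y i) else 0
  have hξ' : ∀ B, MeasurableSet B → ξ' B = ξ (B ∩ sec (U A') ξ) +
      ∑' i, if good i ∧ y i ∈ B then (⊤ : ENNReal) else 0 := by
    intro B hB
    simp only [ξ', Measure.add_apply, Measure.restrict_apply hB, Measure.sum_apply _ hB]
    congr 2
    funext i
    by_cases hi : good i <;> by_cases hyB : y i ∈ B <;>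
      simp [hi, hyB, Measure.dirac_apply' _ hB]
  have hcode : ∀ x, code A' (x, ξ') = code A' (x, ξ) := by
    intro x
    simp only [code, Prod.mk.injEq, true_and]
    funext j
    rw [hξ' _ (hA' j)]
    by_cases hj : ξ (A' j) = ⊤
    · by_cases hj' : ξ (A' j ∩ sec (U A') ξ) < ⊤
      · have : (∑' i, if good i ∧ y i ∈ A' j then (⊤ : ENNReal) else 0) = ⊤ := by
          refine top_unique (le_trans ?_ (ENNReal.le_tsum j))
          simp [show good j from ⟨hj, hj'⟩, (hy j ⟨hj, hj'⟩).1]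
        rw [this, hj, add_top]
      · rw [not_lt, top_le_iff] at hj'
        rw [hj', hj, top_add]
    · have hsub : A' j ⊆ sec (U A') ξ := fun z hz => mem_U.2 ⟨j, hz, lt_top_iff_ne_top.2 hj⟩
      have : (∑' i, if good i ∧ y i ∈ A' j then (⊤ : ENNReal) else 0) = 0 := by
        refine ENNReal.tsum_eq_zero.2 fun i => if_neg ?_
        rintro ⟨hi, hyi⟩
        exact (hy i hi).2.1 (hsub hyi)
      rw [this, add_zero, Set.inter_eq_left.2 hsub]
  have hg' : g ξ' = g ξ := eq_of_code_eq hgvis (hcode x₀)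
  have hS' : sec S ξ' = sec S ξ := by
    ext x
    have := eq_of_code_eq hSvis (hcode x)
    by_cases ha : (x, ξ') ∈ S <;> by_cases hb : (x, ξ) ∈ S <;> simp [ha, hb] at this ⊢
  have hz : ξ' (sec S ξ) = 0 := by
    rw [hξ' _ hsecS]
    have z1 : ξ (sec S ξ ∩ sec (U A') ξ) = 0 := by
      refine measure_mono_null ?_ h2'
      rintro x ⟨hx1, hx2⟩
      exact ⟨hx2, fun hx3 => Set.disjoint_left.1 hSU hx1 hx3⟩
    have z2 : (∑' i, if good i ∧ y i ∈ sec S ξ then (⊤ : ENNReal) else 0) = 0 := by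
      refine ENNReal.tsum_eq_zero.2 fun i => if_neg ?_
      rintro ⟨hi, hyi⟩
      exact (hy i hi).2.2 hyi
    rw [z1, z2, add_zero]
  have := hle ξ'
  rw [hS', hz, hg', h1] at this
  exact hpos (le_antisymm this zero_le)

end

section

open ProbabilityTheory

variable {E : Type*} [MeasurableSpace E]
variable {lam : Measure E} {μ : Measure (Measure E)} {c : E × Measure E → ENNReal} {A : ℕ → Set E}

theorem intensity_zero_or_top [SigmaFinite lam] [IsProbabilityMeasure μ] (hc : Measurable c)
    (hG : GNZ lam μ c) (hA : IsMax lam μ c A) :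
    ∀ᵐ ξ ∂μ, ∀ᵐ x ∂lam, (x, ξ) ∉ U A → c (x, ξ) = 0 ∨ c (x, ξ) = ⊤ := by
  have hU := measurableSet_U hA.meas
  let S : ℕ → ℕ → Set (E × Measure E) := fun m j =>
    ((U A)ᶜ ∩ c ⁻¹' (Set.Iic (m : ENNReal) \ {0})) ∩ Prod.fst ⁻¹' (spanningSets lam j)
  have hS : ∀ m j, MeasurableSet (S m j) := fun m j =>
    (hU.compl.inter (hc (measurableSet_Iic.diff (measurableSet_singleton 0)))).inter
      (measurable_fst (measurableSet_spanningSets lam j))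
  have key : ∀ m j, ∀ᵐ ξ ∂μ, ∀ᵐ x ∂lam, (x, ξ) ∉ S m j := by
    intro m j
    obtain ⟨Q, hQ, h⟩ := exists_forced hc hG hA (hS m j)
      (Set.disjoint_left.2 fun p hp => hp.1.1)
    filter_upwards [h] with ξ hξ
    have hs := measurableSet_sec (hS m j) ξ
    have e1 : kap lam c A ξ (sec (S m j) ξ) = ∫⁻ x in sec (S m j) ξ, c (x, ξ) ∂lam := by
      rw [kap_apply ξ hs]
      have i1 : sec (S m j) ξ ∩ sec (U A) ξ = ∅ := by
        ext x
        simp only [Set.mem_inter_iff, mem_sec, Set.mem_empty_iff_false, iff_false, not_and]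
        exact fun hx => hx.1.1
      have i2 : sec (S m j) ξ ∩ (sec (U A) ξ)ᶜ = sec (S m j) ξ :=
        Set.inter_eq_left.2 fun x hx => hx.1.1
      rw [i1, i2, measure_empty, zero_add]
    have e2 : kap lam c A ξ (sec (S m j) ξ) < ⊤ := by
      rw [e1]
      calc ∫⁻ x in sec (S m j) ξ, c (x, ξ) ∂lam ≤ ∫⁻ x in sec (S m j) ξ, (m : ENNReal) ∂lam :=
            setLIntegral_mono measurable_const fun x hx => hx.1.2.1
        _ = m * lam (sec (S m j) ξ) := by simp
        _ ≤ m * lam (spanningSets lam j) := by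
            gcongr
            exact fun x hx => hx.2
        _ < ⊤ := ENNReal.mul_lt_top (ENNReal.natCast_lt_top m) (measure_spanningSets_lt_top lam j)
    have e3 : kap lam c A ξ (sec (S m j) ξ) = 0 := by
      by_contra hne
      obtain ⟨i, h1, h2⟩ := hξ hne
      have h3 := measure_inter_add_sdiff (μ := kap lam c A ξ) (Q i \ sec (U A) ξ) hs
      rw [h1, h2, add_zero] at h3
      exact e2.ne (top_unique (h3 ▸ measure_mono Set.inter_subset_right))
    rw [e1, setLIntegral_eq_zero_iff hs (measurable_section hc ξ)] at e3
    filter_upwards [e3] with x hx hxS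
    exact hxS.1.2.2 (hx hxS)
  filter_upwards [ae_all_iff.2 fun m => ae_all_iff.2 (key m)] with ξ hξ
  filter_upwards [ae_all_iff.2 fun m => ae_all_iff.2 (hξ m)] with x hx hxU
  by_contra! hcon
  obtain ⟨m, hm⟩ := ENNReal.exists_nat_gt hcon.2
  obtain ⟨j, hj⟩ := Set.mem_iUnion.1 ((iUnion_spanningSets lam).symm ▸ Set.mem_univ x)
  exact hx m j ⟨⟨hxU, hm.le, hcon.1⟩, hj⟩

/-- The invisible pairs with infinite intensity. -/
def Inv (c : E × Measure E → ENNReal) (A : ℕ → Set E) : Set (E × Measure E) :=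
  (U A)ᶜ ∩ c ⁻¹' {⊤}

theorem measurableSet_Inv_vis (hA : IsMax lam μ c A) : MeasurableSet[vis A] (Inv c A) :=
  (measurableSet_U_vis A).compl.inter (hA.vis_c (measurableSet_singleton ⊤))

theorem measurableSet_Inv (hA : IsMax lam μ c A) : MeasurableSet (Inv c A) :=
  vis_le hA.meas _ (measurableSet_Inv_vis hA)

theorem kap_eq_ae [SigmaFinite lam] [IsProbabilityMeasure μ] (hc : Measurable c)
    (hG : GNZ lam μ c) (hA : IsMax lam μ c A) :
    ∀ᵐ ξ ∂μ, kap lam c A ξ =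
      ξ.restrict (sec (U A) ξ) + (⊤ : ENNReal) • lam.restrict (sec (Inv c A) ξ) := by
  filter_upwards [intensity_zero_or_top hc hG hA] with ξ hξ
  have hsU := measurableSet_sec (measurableSet_U hA.meas) ξ
  have hsI := measurableSet_sec (measurableSet_Inv hA) ξ
  unfold kap
  congr 1
  rw [← withDensity_const, ← withDensity_indicator hsU.compl, ← withDensity_indicator hsI]
  refine withDensity_congr_ae ?_
  filter_upwards [hξ] with x hx
  by_cases h : (x, ξ) ∈ U A
  · simp [Inv, h]
  · rcases hx h with h0 | h0 <;> simp [Inv, h, h0]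

/-- Rigidity of the invisible part in terms of the reference measure. -/
theorem exists_forced_lam [SigmaFinite lam] [IsProbabilityMeasure μ] (hc : Measurable c)
    (hG : GNZ lam μ c) (hA : IsMax lam μ c A) {S : Set (E × Measure E)} (hS : MeasurableSet S)
    (hSC : S ⊆ Inv c A) :
    ∃ Q : ℕ → Set E, (∀ i, MeasurableSet (Q i)) ∧ ∀ᵐ ξ ∂μ, lam (sec S ξ) ≠ 0 →
      ∃ i, lam ((Q i ∩ sec (Inv c A) ξ) \ sec S ξ) = 0 ∧
        lam (Q i ∩ sec (Inv c A) ξ) ≠ 0 := by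
  obtain ⟨Q, hQ, h⟩ := exists_forced hc hG hA hS (Set.disjoint_left.2 fun p hp => (hSC hp).1)
  refine ⟨Q, hQ, ?_⟩
  filter_upwards [h, kap_eq_ae hc hG hA] with ξ h1 h2 h3
  have hsU := measurableSet_sec (measurableSet_U hA.meas) ξ
  have hsI := measurableSet_sec (measurableSet_Inv hA) ξ
  have hsS := measurableSet_sec hS ξ
  have key : ∀ B, MeasurableSet B → Disjoint B (sec (U A) ξ) →
      kap lam c A ξ B = ⊤ * lam (B ∩ sec (Inv c A) ξ) := by
    intro B hB hd
    rw [h2, Measure.add_apply, Measure.restrict_apply hB, hd.inter_eq, measure_empty, zero_add,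
      Measure.smul_apply, Measure.restrict_apply hB, smul_eq_mul]
  have hSU : Disjoint (sec S ξ) (sec (U A) ξ) := Set.disjoint_left.2 fun x hx => (hSC hx).1
  obtain ⟨i, h4, h5⟩ := h1 (by
    have hsub : sec S ξ ⊆ sec (Inv c A) ξ := fun x hx => hSC hx
    rw [key _ hsS hSU, Set.inter_eq_left.2 hsub]
    simpa using h3)
  refine ⟨i, ?_, ?_⟩
  · rw [key _ (((hQ i).diff hsU).diff hsS)
      (Set.disjoint_left.2 fun x hx => hx.1.2)] at h4
    have h6 := (mul_eq_zero.1 h4).resolve_left ENNReal.top_ne_zero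
    refine measure_mono_null ?_ h6
    exact fun x hx => ⟨⟨⟨hx.1.1, hx.1.2.1⟩, hx.2⟩, hx.1.2⟩
  · intro h0
    have hsub : (Q i \ sec (U A) ξ) ∩ sec (Inv c A) ξ ⊆ Q i ∩ sec (Inv c A) ξ :=
      fun x hx => ⟨hx.1.1, hx.2⟩
    rw [key _ ((hQ i).diff hsU) (Set.disjoint_left.2 fun x hx => hx.2),
      measure_mono_null hsub h0] at h5
    simp at h5

end

section

open scoped symmDiff

theorem exists_measure_eq (μ : Measure ℝ) [IsFiniteMeasure μ] [NullSingletonClass μ] {t : ENNReal}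
    (ht : t ≤ μ Set.univ) : ∃ B, MeasurableSet B ∧ μ B = t := by
  rcases eq_or_ne t 0 with rfl | h0
  · exact ⟨∅, .empty, measure_empty⟩
  rcases ht.eq_or_lt with rfl | hlt
  · exact ⟨Set.univ, .univ, rfl⟩
  have hcont : Continuous fun x => ∫ _ in Set.Iic x, (1 : ℝ) ∂μ := by
    refine continuous_iff_continuousAt.2 fun x => ?_
    exact ((integrable_const (1 : ℝ)).integrableOn.continuousOn_Iic_primitive_Iic
      (a₀ := x + 1)).continuousAt (Iic_mem_nhds (by linarith))
  simp only [setIntegral_const, smul_eq_mul, mul_one] at hcont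
  have htop : t ≠ ⊤ := hlt.ne_top
  obtain ⟨x, hx⟩ : t.toReal ∈ Set.range fun x => μ.real (Set.Iic x) := by
    refine mem_range_of_exists_le_of_exists_ge hcont ?_ ?_
    · obtain ⟨x, hx⟩ := ((tendsto_measure_Ici_atBot μ).eventually_const_lt
        (ENNReal.sub_lt_self (measure_ne_top μ Set.univ) hlt.ne_bot h0)).exists
      refine ⟨x, ENNReal.toReal_mono htop ?_⟩
      rw [measure_congr Iio_ae_eq_Iic.symm, ← Set.compl_Ici,
        measure_compl measurableSet_Ici (measure_ne_top μ _)]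
      exact tsub_le_iff_tsub_le.1 hx.le
    · obtain ⟨x, hx⟩ := ((tendsto_measure_Iic_atTop μ).eventually_const_lt hlt).exists
      exact ⟨x, ENNReal.toReal_mono (measure_ne_top μ _) hx.le⟩
  exact ⟨Set.Iic x, measurableSet_Iic,
    (ENNReal.toReal_eq_toReal_iff' (measure_ne_top μ _) htop).1 hx⟩

/-- An atomless finite measure on `ℝ` can be split into `N` parts of equal mass. -/
theorem exists_equipartition (N : ℕ) (t : ENNReal) :
    ∀ (μ : Measure ℝ) [IsFiniteMeasure μ] [NullSingletonClass μ],
      μ Set.univ = N * t → ∃ P : ℕ → Set ℝ, (∀ j, MeasurableSet (P j)) ∧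
      Pairwise (Function.onFun Disjoint P) ∧ ∀ j < N, μ (P j) = t := by
  induction N with
  | zero =>
    intro μ _ _ _
    exact ⟨fun _ => ∅, fun _ => .empty, fun _ _ _ => disjoint_bot_left, by simp⟩
  | succ N ih =>
    intro μ _ _ h
    obtain ⟨B, hB, hBt⟩ := exists_measure_eq μ (t := t) (by
      rw [h]; push_cast; rw [add_mul, one_mul]; exact le_add_self)
    have ht : t ≠ ⊤ := hBt ▸ measure_ne_top μ B
    obtain ⟨P, hP, hd, hm⟩ := ih (μ.restrict Bᶜ) (by
      rw [Measure.restrict_apply_univ, measure_compl hB (measure_ne_top μ B), h, hBt]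
      push_cast
      rw [add_mul, one_mul, ENNReal.add_sub_cancel_right ht])
    refine ⟨fun j => if j = 0 then B else P (j - 1) ∩ Bᶜ, fun j => ?_, fun i j hij => ?_,
      fun j hj => ?_⟩
    · dsimp only
      split_ifs
      · exact hB
      · exact (hP _).inter hB.compl
    · dsimp only [Function.onFun]
      split_ifs with h1 h2 h2
      · exact absurd (h1.trans h2.symm) hij
      · exact Set.disjoint_left.2 fun x hx hx' => hx'.2 hx
      · exact Set.disjoint_left.2 fun x hx hx' => hx.2 hx'
      · exact (hd (fun h => hij (by lia))).mono Set.inter_subset_left Set.inter_subset_left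
    · dsimp only
      split_ifs with h1
      · exact hBt
      · rw [← Measure.restrict_apply (hP _)]
        exact hm _ (by lia)

theorem exists_fin_equipartition (μ : Measure ℝ) [IsFiniteMeasure μ] [NullSingletonClass μ] (N : ℕ)
    [NeZero N] : ∃ P : Fin N → Set ℝ, (∀ j, MeasurableSet (P j)) ∧
      Pairwise (Function.onFun Disjoint P) ∧ (∀ j, μ (P j) = μ Set.univ / N) ∧
      μ (⋃ j, P j)ᶜ = 0 := by
  have hdiv : (N : ENNReal) * (μ Set.univ / N) = μ Set.univ :=
    ENNReal.mul_div_cancel (by exact_mod_cast NeZero.ne N) (ENNReal.natCast_ne_top N)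
  obtain ⟨P, hP, hPd, hPm⟩ := exists_equipartition N (μ Set.univ / N) μ hdiv.symm
  have hd : Pairwise (Function.onFun Disjoint fun j : Fin N => P j) :=
    fun i j hij => hPd fun h => hij (Fin.ext h)
  refine ⟨fun j => P j, fun j => hP _, hd, fun j => hPm j j.2, ?_⟩
  rw [measure_compl (MeasurableSet.iUnion fun j => hP _) (measure_ne_top _ _),
    measure_iUnion hd fun j => hP _, tsum_fintype, Finset.sum_congr rfl fun (j : Fin N) _ => hPm j j.2]
  simp [hdiv]

theorem sum_measure_inter_of_conull {X ι : Type*} [MeasurableSpace X] [Fintype ι] {μ : Measure X}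
    {P : ι → Set X} (hP : ∀ j, MeasurableSet (P j)) (hd : Pairwise (Function.onFun Disjoint P))
    (hu : μ (⋃ j, P j)ᶜ = 0) {B : Set X} (hB : MeasurableSet B) : ∑ j, μ (B ∩ P j) = μ B := by
  rw [← tsum_fintype (L := .unconditional _), ← measure_iUnion (fun i j hij =>
    (hd hij).mono Set.inter_subset_right Set.inter_subset_right) fun j => hB.inter (hP j),
    ← Set.inter_iUnion, measure_inter_conull hu]

/-- A set of small measure that meets `C` inside each rectangle filling most of `I ×ˢ J`. -/
theorem exists_small_meeting (μ ν : Measure ℝ) [IsFiniteMeasure μ] [IsFiniteMeasure ν] [NullSingletonClass μ]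
    [NullSingletonClass ν] {C : Set (ℝ × ℝ)} (hC : MeasurableSet C) {I J : Set ℝ} (hI : MeasurableSet I)
    (hJ : MeasurableSet J) {ε : ENNReal} (hε : ε ≠ 0) :
    ∃ D, MeasurableSet D ∧ (μ.prod ν) D ≤ ε ∧ ∀ A B, MeasurableSet A → MeasurableSet B →
      μ (I \ A) * ν J + μ I * ν (J \ B) < (μ.prod ν) (C ∩ I ×ˢ J) →
        (μ.prod ν) (D ∩ C ∩ A ×ˢ B) ≠ 0 := by
  obtain ⟨N, hN⟩ := ENNReal.exists_nat_mul_gt hε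
    (ENNReal.mul_ne_top (measure_ne_top μ I) (measure_ne_top ν J))
  have hN0 : N ≠ 0 := by
    rintro rfl
    simp at hN
  have : NeZero N := ⟨hN0⟩
  have hNE : (N : ENNReal) ≠ 0 := by exact_mod_cast hN0
  have hNT := ENNReal.natCast_ne_top N
  obtain ⟨P, hP, hPd, hPm, hPu⟩ := exists_fin_equipartition (μ.restrict I) N
  obtain ⟨Q, hQ, hQd, hQm, hQu⟩ := exists_fin_equipartition (ν.restrict J) N
  rw [Measure.restrict_apply_univ] at hPm hQm
  let m := (μ.restrict I).prod (ν.restrict J)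
  have hm : m = (μ.prod ν).restrict (I ×ˢ J) := Measure.prod_restrict I J
  let T : Fin N → Fin N → Set (ℝ × ℝ) := fun r j => P j ×ˢ Q (j + r)
  have hT : ∀ r j, MeasurableSet (T r j) := fun r j => (hP _).prod (hQ _)
  have hTd : ∀ r, Pairwise (Function.onFun Disjoint (T r)) := fun r i j hij =>
    Set.disjoint_prod.2 (.inl (hPd hij))
  let D : Fin N → Set (ℝ × ℝ) := fun r => ⋃ j, T r j
  have hD : ∀ r, MeasurableSet (D r) := fun r => MeasurableSet.iUnion fun j => hT r j
  have hsum : ∀ r S, MeasurableSet S → m (D r ∩ S) = ∑ j, m (T r j ∩ S) := by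
    intro r S hS
    rw [Set.iUnion_inter, measure_iUnion (fun i j hij =>
      (hTd r hij).mono Set.inter_subset_left Set.inter_subset_left) fun j => (hT r j).inter hS,
      tsum_fintype]
  have hDu : m (⋃ r, D r)ᶜ = 0 := by
    have hsub : (⋃ r, D r)ᶜ ⊆ (⋃ j, P j)ᶜ ×ˢ Set.univ ∪
        Set.univ ×ˢ (⋃ j, Q j)ᶜ := by
      intro p hp
      by_contra hn
      simp only [Set.mem_union, Set.mem_prod, Set.mem_compl_iff, Set.mem_univ, and_true, true_and,
        not_or, not_not, Set.mem_iUnion] at hn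
      obtain ⟨⟨j, hj⟩, ⟨k, hk⟩⟩ := hn
      refine hp (Set.mem_iUnion.2 ⟨k - j, Set.mem_iUnion.2 ⟨j, hj, ?_⟩⟩)
      rwa [add_sub_cancel]
    refine measure_mono_null hsub (measure_union_null ?_ ?_)
    · rw [Measure.prod_prod, hPu, zero_mul]
    · rw [Measure.prod_prod, hQu, mul_zero]
  obtain ⟨r, hr⟩ : ∃ r, m C ≤ N * m (D r ∩ C) := by
    by_contra! h
    have hle : m C ≤ ∑ r, m (D r ∩ C) := by
      calc m C ≤ m ((⋃ r, D r ∩ C) ∪ (⋃ r, D r)ᶜ) := by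
            refine measure_mono fun p hp => ?_
            rw [← Set.iUnion_inter]
            by_cases h : p ∈ ⋃ r, D r
            · exact .inl ⟨h, hp⟩
            · exact .inr h
        _ ≤ m (⋃ r, D r ∩ C) + m (⋃ r, D r)ᶜ := measure_union_le _ _
        _ = m (⋃ r, D r ∩ C) := by rw [hDu, add_zero]
        _ ≤ ∑ r, m (D r ∩ C) := measure_iUnion_fintype_le m _
    have hlt : (N : ENNReal) * ∑ r, m (D r ∩ C) < N * m C := by
      rw [Finset.mul_sum]
      calc ∑ r, N * m (D r ∩ C) < ∑ r : Fin N, m C :=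
            ENNReal.sum_lt_sum_of_nonempty Finset.univ_nonempty fun r _ => h r
        _ = N * m C := by simp
    exact absurd (mul_le_mul_right hle (N : ENNReal)) (not_le.2 hlt)
  have hDA : ∀ A, MeasurableSet A → N * m (D r ∩ A ×ˢ Set.univ) = (μ.restrict I) A * ν J := by
    intro A hA
    have e : ∀ j, m (T r j ∩ A ×ˢ Set.univ) = (μ.restrict I) (A ∩ P j) * (ν J / N) := by
      intro j
      rw [Set.prod_inter_prod, Set.inter_univ, Measure.prod_prod, hQm, Set.inter_comm]
    rw [hsum r _ (hA.prod .univ), Finset.sum_congr rfl fun j _ => e j, ← Finset.sum_mul,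
      sum_measure_inter_of_conull hP hPd hPu hA, mul_left_comm, ENNReal.mul_div_cancel hNE hNT]
  have hDB : ∀ B, MeasurableSet B → N * m (D r ∩ Set.univ ×ˢ B) = μ I * (ν.restrict J) B := by
    intro B hB
    have e : ∀ j, m (T r j ∩ Set.univ ×ˢ B) = (μ I / N) * (ν.restrict J) (B ∩ Q (j + r)) := by
      intro j
      rw [Set.prod_inter_prod, Set.inter_univ, Measure.prod_prod, hPm, Set.inter_comm]
    rw [hsum r _ (.prod .univ hB), Finset.sum_congr rfl fun j _ => e j, ← Finset.mul_sum,
      Fintype.sum_equiv (Equiv.addRight r) (fun j => (ν.restrict J) (B ∩ Q (j + r)))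
        (fun j => (ν.restrict J) (B ∩ Q j)) fun j => rfl,
      sum_measure_inter_of_conull hQ hQd hQu hB, ← mul_assoc, ENNReal.mul_div_cancel hNE hNT]
  refine ⟨D r ∩ I ×ˢ J, (hD r).inter (hI.prod hJ), ?_, fun A B hA hB hAB h0 => ?_⟩
  · rw [← Measure.restrict_apply (hD r), ← hm]
    have h1 := hDA Set.univ .univ
    rw [Set.univ_prod_univ, Set.inter_univ, Measure.restrict_apply_univ] at h1
    refine (ENNReal.mul_le_mul_iff_right hNE hNT).1 ?_
    rw [h1]
    exact hN.le
  · have h1 : m (D r ∩ C ∩ A ×ˢ B) = 0 := by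
      rw [hm, Measure.restrict_apply (((hD r).inter hC).inter (hA.prod hB))]
      refine measure_mono_null (fun p hp => ?_) h0
      exact ⟨⟨⟨hp.1.1.1, hp.2⟩, hp.1.1.2⟩, hp.1.2⟩
    have h2 : m (D r ∩ C) ≤ m (D r ∩ Aᶜ ×ˢ Set.univ) + m (D r ∩ Set.univ ×ˢ Bᶜ) := by
      have hsub : D r ∩ C ⊆
          D r ∩ C ∩ A ×ˢ B ∪ (D r ∩ Aᶜ ×ˢ Set.univ ∪ D r ∩ Set.univ ×ˢ Bᶜ) := by
        rintro p ⟨hp, hpC⟩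
        by_cases h1 : p.1 ∈ A
        · by_cases h2 : p.2 ∈ B
          · exact .inl ⟨⟨hp, hpC⟩, h1, h2⟩
          · exact .inr (.inr ⟨hp, trivial, h2⟩)
        · exact .inr (.inl ⟨hp, h1, trivial⟩)
      refine (measure_mono hsub).trans ((measure_union_le _ _).trans ?_)
      rw [h1, zero_add]
      exact measure_union_le _ _
    have h3 : m C ≤ μ (I \ A) * ν J + μ I * ν (J \ B) := by
      refine hr.trans ((mul_le_mul_right h2 _).trans ?_)
      rw [mul_add, hDA _ hA.compl, hDB _ hB.compl, Measure.restrict_apply hA.compl,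
        Measure.restrict_apply hB.compl, Set.inter_comm, Set.inter_comm Bᶜ,
        ← Set.sdiff_eq, ← Set.sdiff_eq]
    rw [hm, Measure.restrict_apply hC] at h3
    exact absurd h3 (not_le.2 hAB)

/-- A small set that meets `C` inside each rectangle charging `C`. -/
theorem exists_meeting (μ ν : Measure ℝ) [IsFiniteMeasure μ] [IsFiniteMeasure ν]
    [NullSingletonClass μ] [NullSingletonClass ν] {C : Set (ℝ × ℝ)} (hC : MeasurableSet C)
    (h0 : (μ.prod ν) C ≠ 0) :
    ∃ D, MeasurableSet D ∧ (μ.prod ν) (C \ D) ≠ 0 ∧ ∀ A B, MeasurableSet A → MeasurableSet B →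
      (μ.prod ν) (C ∩ A ×ˢ B) ≠ 0 → (μ.prod ν) (D ∩ C ∩ A ×ˢ B) ≠ 0 := by
  obtain ⟨𝒜, h𝒜c, h𝒜⟩ := exists_countable_measureDense μ
  obtain ⟨ℬ, hℬc, hℬ⟩ := exists_countable_measureDense ν
  have := h𝒜c.to_subtype
  have := hℬc.to_subtype
  obtain ⟨ε, hε, hsum⟩ := ENNReal.exists_pos_sum_of_countable' h0 (𝒜 × ℬ)
  choose D hD hDε hDm using fun i : 𝒜 × ℬ => exists_small_meeting μ ν hC
    (h𝒜.measurable _ i.1.2) (hℬ.measurable _ i.2.2) (hε i).ne'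
  refine ⟨⋃ i, D i, MeasurableSet.iUnion hD, fun h => ?_, fun A B hA hB hAB => ?_⟩
  · refine absurd hsum (not_lt.2 ?_)
    calc (μ.prod ν) C ≤ (μ.prod ν) (C \ ⋃ i, D i) + (μ.prod ν) (⋃ i, D i) := by
          refine (measure_mono fun p hp => ?_).trans (measure_union_le _ _)
          by_cases h : p ∈ ⋃ i, D i
          · exact .inr h
          · exact .inl ⟨hp, h⟩
      _ = (μ.prod ν) (⋃ i, D i) := by rw [h, zero_add]
      _ ≤ ∑' i, (μ.prod ν) (D i) := measure_iUnion_le _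
      _ ≤ ∑' i, ε i := ENNReal.tsum_le_tsum hDε
  · obtain ⟨δ, hδ0, hδ⟩ : ∃ δ : ℝ, 0 < δ ∧ ENNReal.ofReal δ * (2 * (μ Set.univ + ν Set.univ)) <
        (μ.prod ν) (C ∩ A ×ˢ B) := by
      obtain ⟨δ, hδ0, hδ⟩ := ENNReal.exists_nnreal_pos_mul_lt
        (a := 2 * (μ Set.univ + ν Set.univ)) (by finiteness) hAB
      exact ⟨δ, hδ0, by rwa [ENNReal.ofReal_coe_nnreal]⟩
    obtain ⟨I, hI, hIA⟩ := h𝒜.approx A hA (measure_ne_top _ _) δ hδ0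
    obtain ⟨J, hJ, hJB⟩ := hℬ.approx B hB (measure_ne_top _ _) δ hδ0
    have hmI := h𝒜.measurable I hI
    have hmJ := hℬ.measurable J hJ
    refine fun hnull => hDm (⟨I, hI⟩, ⟨J, hJ⟩) A B hA hB ?_ (measure_mono_null ?_ hnull)
    · have h1 : μ (I \ A) ≤ ENNReal.ofReal δ := (measure_mono fun x hx => .inr hx).trans hIA.le
      have h2 : μ (A \ I) ≤ ENNReal.ofReal δ := (measure_mono fun x hx => .inl hx).trans hIA.le
      have h3 : ν (J \ B) ≤ ENNReal.ofReal δ := (measure_mono fun x hx => .inr hx).trans hJB.le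
      have h4 : ν (B \ J) ≤ ENNReal.ofReal δ := (measure_mono fun x hx => .inl hx).trans hJB.le
      have hsub : C ∩ A ×ˢ B ⊆ C ∩ I ×ˢ J ∪ ((A \ I) ×ˢ Set.univ ∪ Set.univ ×ˢ (B \ J)) := by
        rintro p ⟨hp, hpA, hpB⟩
        by_cases h1 : p.1 ∈ I
        · by_cases h2 : p.2 ∈ J
          · exact .inl ⟨hp, h1, h2⟩
          · exact .inr (.inr ⟨trivial, hpB, h2⟩)
        · exact .inr (.inl ⟨⟨hpA, h1⟩, trivial⟩)
      have hle : (μ.prod ν) (C ∩ A ×ˢ B) ≤ (μ.prod ν) (C ∩ I ×ˢ J) +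
          (ENNReal.ofReal δ * ν Set.univ + μ Set.univ * ENNReal.ofReal δ) := by
        refine (measure_mono hsub).trans ((measure_union_le _ _).trans ?_)
        gcongr
        refine (measure_union_le _ _).trans ?_
        rw [Measure.prod_prod, Measure.prod_prod]
        gcongr
      have hle' : μ (I \ A) * ν J + μ I * ν (J \ B) ≤
          ENNReal.ofReal δ * ν Set.univ + μ Set.univ * ENNReal.ofReal δ := by
        gcongr <;> exact Set.subset_univ _
      refine lt_of_le_of_lt hle' ?_
      have hfin : ENNReal.ofReal δ * ν Set.univ + μ Set.univ * ENNReal.ofReal δ ≠ ⊤ := by finiteness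
      refine (ENNReal.add_lt_add_iff_right hfin).1 (lt_of_lt_of_le (lt_of_eq_of_lt ?_ hδ) hle)
      ring
    · exact fun p hp => ⟨⟨Set.mem_iUnion.2 ⟨_, hp.1.1⟩, hp.1.2⟩, hp.2⟩

theorem exists_restrict_equiv {X : Type*} [MeasurableSpace X] {α μ : Measure X} [SigmaFinite α]
    [SigmaFinite μ] (h : α ≪ μ) : ∃ A, MeasurableSet A ∧ α ≪ μ.restrict A ∧ μ.restrict A ≪ α := by
  have hm := Measure.measurable_rnDeriv α μ
  have hA : MeasurableSet {x | α.rnDeriv μ x ≠ 0} := hm (measurableSet_singleton 0).compl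
  have key : ∀ s, α s = 0 ↔ μ.restrict {x | α.rnDeriv μ x ≠ 0} s = 0 := fun s => by
    nth_rw 1 [← Measure.withDensity_rnDeriv_eq α μ h]
    rw [withDensity_apply_eq_zero hm, Measure.restrict_apply' hA, Set.inter_comm]
  exact ⟨_, hA, fun s => (key s).2, fun s => (key s).1⟩

/-- `exists_meeting` for measures that are absolutely continuous. -/
theorem exists_meeting_ac (μ ν : Measure ℝ) [IsFiniteMeasure μ] [IsFiniteMeasure ν]
    [NullSingletonClass μ] [NullSingletonClass ν] {C : Set (ℝ × ℝ)} (hC : MeasurableSet C)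
    (h0 : (μ.prod ν) C ≠ 0) :
    ∃ D, MeasurableSet D ∧ (μ.prod ν) (C \ D) ≠ 0 ∧ ∀ α β : Measure ℝ, IsFiniteMeasure α →
      IsFiniteMeasure β → α ≪ μ → β ≪ ν → (α.prod β) C ≠ 0 → (α.prod β) (D ∩ C) ≠ 0 := by
  obtain ⟨D, hD, hpos, h⟩ := exists_meeting μ ν hC h0
  refine ⟨D, hD, hpos, fun α β _ _ hα hβ hαβ hnull => ?_⟩
  obtain ⟨A, hA, h1, h2⟩ := exists_restrict_equiv hα
  obtain ⟨B, hB, h3, h4⟩ := exists_restrict_equiv hβ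
  refine h A B hA hB (fun h0 => hαβ (h1.prod h3 ?_)) ?_
  · rwa [Measure.prod_restrict, Measure.restrict_apply hC]
  · rw [← Measure.restrict_apply (hD.inter hC), ← Measure.prod_restrict]
    exact h2.prod h4 hnull

end

section

variable {E : Type*} [MeasurableSpace E]

theorem prod_eq_zero_iff {lam : Measure E} [SFinite lam] {μ : Measure (Measure E)} [SFinite μ]
    {S : Set (E × Measure E)} (hS : MeasurableSet S) :
    (lam.prod μ) S = 0 ↔ ∀ᵐ ξ ∂μ, lam (sec S ξ) = 0 := by
  rw [Measure.prod_apply_symm hS, lintegral_eq_zero_iff (measurable_measure_prodMk_right hS)]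
  rfl

/-- The atoms of a measure. -/
def atoms {X : Type*} [MeasurableSpace X] (m : Measure X) : Set X := {t | m {t} ≠ 0}

theorem countable_atoms {X : Type*} [MeasurableSpace X] [MeasurableSingletonClass X]
    (m : Measure X) [SFinite m] : (atoms m).Countable := by
  have h := Measure.countable_meas_pos_of_disjoint_iUnion (μ := m) (As := fun t : X => {t})
    (fun t => measurableSet_singleton t) fun s t hst => Set.disjoint_singleton.2 hst
  simp only [pos_iff_ne_zero] at h
  exact h

theorem nullSingletonClass_restrict_atoms {X : Type*} [MeasurableSpace X]
    [MeasurableSingletonClass X] (m : Measure X) [SFinite m] :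
    NullSingletonClass (m.restrict (atoms m)ᶜ) := by
  refine ⟨fun t => ?_⟩
  rw [Measure.restrict_apply (measurableSet_singleton t)]
  by_cases h : t ∈ atoms m
  · rw [Set.singleton_inter_eq_empty.2 (Set.notMem_compl_iff.2 h), measure_empty]
  · exact measure_mono_null Set.inter_subset_left (not_not.1 h)

/-- If each measurable part of `C` contains rectangular pieces of `C`, then `C` is carried by
rectangles. -/
theorem diffuse_part_null {lam : Measure E} [IsFiniteMeasure lam] {μ : Measure (Measure E)}
    [IsFiniteMeasure μ] {e : E → ℝ} {v : Measure E → ℝ} (he : Measurable e) (hv : Measurable v)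
    {Z : Set (ℝ × ℝ)} (hZ : MeasurableSet Z)
    (H : ∀ S, MeasurableSet S → S ⊆ Prod.map e v ⁻¹' Z → ∃ Q : ℕ → Set E,
      (∀ i, MeasurableSet (Q i)) ∧ ∀ᵐ ξ ∂μ, lam (sec S ξ) ≠ 0 →
        ∃ i, lam ((Q i ∩ sec (Prod.map e v ⁻¹' Z) ξ) \ sec S ξ) = 0 ∧
          lam (Q i ∩ sec (Prod.map e v ⁻¹' Z) ξ) ≠ 0) :
    ∀ᵐ ξ ∂μ, v ξ ∉ atoms (μ.map v) →
      lam {x | e x ∉ atoms (lam.map e) ∧ (e x, v ξ) ∈ Z} = 0 := by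
  have hev : Measurable (Prod.map e v) := he.prodMap hv
  have hC := hev hZ
  set C : Set (E × Measure E) := Prod.map e v ⁻¹' Z with hCdef
  let R : Set ℝ := (atoms (lam.map e))ᶜ
  let T : Set ℝ := (atoms (μ.map v))ᶜ
  have hR : MeasurableSet R := (countable_atoms _).measurableSet.compl
  have hT : MeasurableSet T := (countable_atoms _).measurableSet.compl
  have hprod : ∀ (Q : Set E) (B : Set (Measure E)), MeasurableSet Q → MeasurableSet B →
      ∀ W : Set (ℝ × ℝ), MeasurableSet W →
      ((((lam.restrict Q).map e).prod ((μ.restrict B).map v)) W = 0 ↔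
        ∀ᵐ ξ ∂μ, ξ ∈ B → lam (sec (Prod.map e v ⁻¹' W) ξ ∩ Q) = 0) := by
    intro Q B hQ hB W hW
    rw [Measure.map_prod_map _ _ he hv, Measure.map_apply hev hW, prod_eq_zero_iff (hev hW),
      ae_restrict_iff' hB]
    simp only [Measure.restrict_apply (measurableSet_sec (hev hW) _)]
  have hlR : (lam.map e).restrict R = (lam.restrict (e ⁻¹' R)).map e := Measure.restrict_map he hR
  have hmT : (μ.map v).restrict T = (μ.restrict (v ⁻¹' T)).map v := Measure.restrict_map hv hT
  have := nullSingletonClass_restrict_atoms (lam.map e)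
  have := nullSingletonClass_restrict_atoms (μ.map v)
  have main : (((lam.map e).restrict R).prod ((μ.map v).restrict T)) Z = 0 := by
    by_contra h0
    obtain ⟨D, hD, hpos, hmeet⟩ := exists_meeting_ac _ _ hZ h0
    let S : Set (E × Measure E) := Prod.map e v ⁻¹' ((Z \ D) ∩ R ×ˢ T)
    have hS : MeasurableSet S := hev ((hZ.diff hD).inter (hR.prod hT))
    obtain ⟨Q, hQ, hQS⟩ := H S hS fun p hp => hp.1.1
    let B : ℕ → Set (Measure E) := fun i => {ξ | v ξ ∈ T ∧
      lam (sec ((Q i ×ˢ Set.univ ∩ C) \ S) ξ) = 0 ∧ lam (sec (Q i ×ˢ Set.univ ∩ C) ξ) ≠ 0}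
    have hB : ∀ i, MeasurableSet (B i) := by
      intro i
      have hQC : MeasurableSet (Q i ×ˢ Set.univ ∩ C) := ((hQ i).prod .univ).inter hC
      exact (hv hT).inter (((measurable_measure_prodMk_right (hQC.diff hS))
        (measurableSet_singleton 0)).inter
          ((measurable_measure_prodMk_right hQC) (measurableSet_singleton 0).compl))
    have hB0 : ∀ i, μ (B i) = 0 := by
      intro i
      by_contra hBi
      refine hmeet ((lam.restrict (Q i ∩ e ⁻¹' R)).map e) ((μ.restrict (B i)).map v)
        inferInstance inferInstance ?_ ?_ ?_ ?_
      · rw [hlR]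
        exact (Measure.restrict_mono_set _ Set.inter_subset_right).absolutelyContinuous.map he
      · rw [hmT]
        exact (Measure.restrict_mono_set _ fun ξ hξ => hξ.1).absolutelyContinuous.map hv
      · rw [Ne, hprod _ _ ((hQ i).inter (he hR)) (hB i) _ hZ]
        intro h
        refine hBi (measure_eq_zero_iff_ae_notMem.2 ?_)
        filter_upwards [h] with ξ h1 h2
        refine h2.2.2 (measure_mono_null (t := sec C ξ ∩ (Q i ∩ e ⁻¹' R) ∪
          sec ((Q i ×ˢ Set.univ ∩ C) \ S) ξ) (fun x hx => ?_)
          (measure_union_null (h1 h2) h2.2.1))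
        by_cases hxS : (x, ξ) ∈ S
        · exact .inl ⟨hx.2, hx.1.1, hxS.2.1⟩
        · exact .inr ⟨hx, hxS⟩
      · rw [hprod _ _ ((hQ i).inter (he hR)) (hB i) _ (hD.inter hZ)]
        filter_upwards with ξ hξ
        refine measure_mono_null (fun x hx => ?_) hξ.2.1
        exact ⟨⟨⟨hx.2.1, trivial⟩, hx.1.2⟩, fun h => h.1.2 hx.1.1⟩
    refine hpos ?_
    rw [hlR, hmT, hprod _ _ (he hR) (hv hT) _ (hZ.diff hD)]
    filter_upwards [hQS, ae_all_iff.2 fun i => measure_eq_zero_iff_ae_notMem.1 (hB0 i)]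
      with ξ h1 h2 h3
    by_contra h4
    obtain ⟨i, hi1, hi2⟩ := h1 fun h5 => h4
      (measure_mono_null (t := sec S ξ) (fun x hx => ⟨hx.1, hx.2, h3⟩) h5)
    refine h2 i ⟨h3, measure_mono_null (fun x hx => ?_) hi1,
      fun h => hi2 (measure_mono_null (fun x hx => ?_) h)⟩
    · exact ⟨⟨hx.1.1.1, hx.1.2⟩, hx.2⟩
    · exact ⟨⟨hx.1, trivial⟩, hx.2⟩
  rw [hlR, hmT, hprod _ _ (he hR) (hv hT) _ hZ] at main
  filter_upwards [main] with ξ h1 h2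
  exact measure_mono_null (t := sec (Prod.map e v ⁻¹' Z) ξ ∩ e ⁻¹' R)
    (fun x hx => ⟨hx.2, hx.1⟩) (h1 h2)

end

section

variable {E : Type*} [MeasurableSpace E]
variable {lam : Measure E} {μ : Measure (Measure E)} {c : E × Measure E → ENNReal} {A : ℕ → Set E}

/-- Visible sets are preimages of planar sets. -/
theorem exists_planar (hA : ∀ i, MeasurableSet (A i)) : ∃ (e : E → ℝ) (v : Measure E → ℝ),
    Measurable e ∧ Measurable v ∧ ∀ D, MeasurableSet[vis A] D →
      ∃ Z, MeasurableSet Z ∧ D = Prod.map e v ⁻¹' Z := by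
  let a := embeddingReal (ℕ → ENNReal)
  have ha : MeasurableEmbedding a := measurableEmbedding_embeddingReal _
  refine ⟨fun x => a fun i => (A i).indicator 1 x, fun ξ => a fun i => ξ (A i), ?_, ?_, ?_⟩
  · exact ha.measurable.comp (measurable_pi_lambda _ fun i => measurable_one.indicator (hA i))
  · exact ha.measurable.comp (measurable_pi_lambda _ fun i => Measure.measurable_coe (hA i))
  · rintro D ⟨s, hs, rfl⟩
    have hab : MeasurableEmbedding (Prod.map a a) := ha.prodMap ha
    refine ⟨Prod.map a a '' s, hab.measurableSet_image.2 hs, ?_⟩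
    ext p
    change code A p ∈ s ↔ Prod.map a a (code A p) ∈ Prod.map a a '' s
    exact (hab.injective.mem_set_image).symm

theorem measure_inter_Inv_ne_zero {ξ ζ : Measure E}
    (hU : sec (U A) ξ = sec (U A) ζ)
    (hξ : kap lam c A ξ = ξ.restrict (sec (U A) ξ) + (⊤ : ENNReal) • lam.restrict (sec (Inv c A) ξ))
    (hζ : kap lam c A ζ = ζ.restrict (sec (U A) ζ) + (⊤ : ENNReal) • lam.restrict (sec (Inv c A) ζ))
    {Q : Set E} (hQ : MeasurableSet Q) (hξQ : kap lam c A ξ Q = ξ Q) (hζQ : kap lam c A ζ Q = ζ Q)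
    (htop : ξ Q = ⊤ → ζ Q = ⊤) (hQξ : Q ⊆ sec (Inv c A) ξ) (h0 : lam Q ≠ 0) :
    lam (Q ∩ sec (Inv c A) ζ) ≠ 0 := by
  intro h
  have h1 : ξ Q = ⊤ := by
    rw [← hξQ, hξ, Measure.add_apply, Measure.smul_apply, Measure.restrict_apply hQ (μ := lam),
      Set.inter_eq_left.2 hQξ, smul_eq_mul, ENNReal.top_mul h0, add_top]
  have hd : Q ∩ sec (U A) ζ = ∅ := by
    rw [← hU, ← Set.disjoint_iff_inter_eq_empty]
    exact Set.disjoint_left.2 fun x hx => (hQξ hx).1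
  have h2 := htop h1
  rw [← hζQ, hζ, Measure.add_apply, Measure.smul_apply, Measure.restrict_apply hQ,
    Measure.restrict_apply hQ, hd, h] at h2
  simp at h2

/-- Adding a particle does not change the region of infinite intensity. -/
theorem ae_Inv_add_dirac [SigmaFinite lam] [IsProbabilityMeasure μ] (hc : Measurable c)
    (hG : GNZ lam μ c) (hA : IsMax lam μ c A) : ∀ᵐ ξ ∂μ, ∀ᵐ x ∂lam, c (x, ξ) ≠ 0 →
      sec (Inv c A) (ξ + Measure.dirac x) =ᵐ[lam] sec (Inv c A) ξ := by
  obtain ⟨e, v, he, hv, hZ⟩ := exists_planar hA.meas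
  obtain ⟨Z, hZ, hCZ⟩ := hZ _ (measurableSet_Inv_vis hA)
  have hnull : ∀ s, lam.toFinite s = 0 ↔ lam s = 0 := fun s =>
    ⟨fun h => absolutelyContinuous_toFinite lam h, fun h => toFinite_absolutelyContinuous lam h⟩
  let α := atoms (lam.toFinite.map e)
  let β := atoms (μ.map v)
  have hα : α.Countable := countable_atoms _
  have hβ : β.Countable := countable_atoms _
  let C : ℝ → Set E := fun t => {x | (e x, t) ∈ Z}
  have hC : ∀ t, MeasurableSet (C t) := fun t => (he.prodMk measurable_const) hZ
  have hsec : ∀ ξ, sec (Inv c A) ξ = C (v ξ) := fun ξ => by rw [hCZ]; rfl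
  have hdiff : ∀ᵐ ξ ∂μ, v ξ ∉ β → lam (C (v ξ) ∩ e ⁻¹' αᶜ) = 0 := by
    have := diffuse_part_null (lam := lam.toFinite) (μ := μ) he hv hZ fun S hS hSC => by
      obtain ⟨Q, hQ, h⟩ := exists_forced_lam hc hG hA hS (hCZ ▸ hSC)
      refine ⟨Q, hQ, ?_⟩
      simp only [Ne, hnull, ← hCZ]
      exact h
    filter_upwards [this] with ξ hξ hvξ
    rw [← hnull]
    exact measure_mono_null (t := {x | e x ∉ α ∧ (e x, v ξ) ∈ Z}) (fun x hx => ⟨hx.2, hx.1⟩)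
      (hξ hvξ)
  have := hα.to_subtype
  have := hβ.to_subtype
  let G : Measure E → Prop := fun ξ =>
    (kap lam c A ξ = ξ.restrict (sec (U A) ξ) + (⊤ : ENNReal) • lam.restrict (sec (Inv c A) ξ)) ∧
    (v ξ ∉ β → lam (C (v ξ) ∩ e ⁻¹' αᶜ) = 0) ∧
    (∀ t : α, kap lam c A ξ (e ⁻¹' {t.1}) = ξ (e ⁻¹' {t.1})) ∧
    (∀ t : β × β, kap lam c A ξ (C t.1 \ C t.2) = ξ (C t.1 \ C t.2)) ∧
    ∀ t : β, kap lam c A ξ (C t ∩ e ⁻¹' αᶜ) = ξ (C t ∩ e ⁻¹' αᶜ)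
  have hm1 : ∀ t : ℝ, MeasurableSet (e ⁻¹' {t}) := fun t => he (measurableSet_singleton t)
  have hm2 : ∀ s t : ℝ, MeasurableSet (C s \ C t) := fun s t => (hC s).diff (hC t)
  have hm3 : ∀ t, MeasurableSet (C t ∩ e ⁻¹' αᶜ) := fun t =>
    (hC t).inter (he hα.measurableSet.compl)
  have hGae : ∀ᵐ ξ ∂μ, G ξ := by
    filter_upwards [kap_eq_ae hc hG hA, hdiff,
      ae_all_iff.2 fun t : α => kap_apply_ae hc hG hA (hm1 t),
      ae_all_iff.2 fun t : β × β => kap_apply_ae hc hG hA (hm2 t.1 t.2),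
      ae_all_iff.2 fun t : β => kap_apply_ae hc hG hA (hm3 t)] with ξ h1 h2 h3 h4 h5
    exact ⟨h1, h2, h3, h4, h5⟩
  have key : ∀ ξ ζ, G ξ → G ζ → sec (U A) ξ = sec (U A) ζ →
      (∀ Q, MeasurableSet Q → ξ Q = ⊤ → ζ Q = ⊤) → lam (C (v ξ) \ C (v ζ)) = 0 := by
    intro ξ ζ hξ hζ hU htop
    have step : ∀ Q, MeasurableSet Q → kap lam c A ξ Q = ξ Q → kap lam c A ζ Q = ζ Q →
        Q ⊆ C (v ξ) → lam (Q ∩ C (v ζ)) = 0 → lam Q = 0 := by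
      intro Q hQ h1 h2 h3 h4
      by_contra h0
      refine measure_inter_Inv_ne_zero hU hξ.1 hζ.1 hQ h1 h2 (htop Q hQ) ?_ h0 ?_
      · rwa [hsec]
      · rwa [hsec]
    have hatom : lam ((C (v ξ) \ C (v ζ)) ∩ e ⁻¹' α) = 0 := by
      have : (C (v ξ) \ C (v ζ)) ∩ e ⁻¹' α ⊆
          ⋃ t : α, (C (v ξ) \ C (v ζ)) ∩ e ⁻¹' {t.1} := fun x hx =>
        Set.mem_iUnion.2 ⟨⟨e x, hx.2⟩, hx.1, rfl⟩
      refine measure_mono_null this (measure_iUnion_null fun t => ?_)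
      by_cases h1 : (t.1, v ξ) ∈ Z ∧ (t.1, v ζ) ∉ Z
      · refine measure_mono_null Set.inter_subset_right
          (step _ (hm1 t) (hξ.2.2.1 t) (hζ.2.2.1 t) ?_ ?_)
        · intro x hx
          change (e x, v ξ) ∈ Z
          rw [Set.mem_singleton_iff.1 hx]
          exact h1.1
        · refine measure_mono_null (t := ∅) (fun x hx => h1.2 ?_) measure_empty
          rw [← Set.mem_singleton_iff.1 hx.1]
          exact hx.2
      · refine measure_mono_null (t := ∅) (fun x hx => h1 ?_) measure_empty
        rw [← Set.mem_singleton_iff.1 hx.2]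
        exact hx.1
    have hdiffuse : lam ((C (v ξ) \ C (v ζ)) ∩ e ⁻¹' αᶜ) = 0 := by
      by_cases h1 : v ξ ∈ β
      · by_cases h2 : v ζ ∈ β
        · refine measure_mono_null Set.inter_subset_left (step _ (hm2 _ _)
            (hξ.2.2.2.1 (⟨_, h1⟩, ⟨_, h2⟩)) (hζ.2.2.2.1 (⟨_, h1⟩, ⟨_, h2⟩)) Set.sdiff_subset ?_)
          rw [Set.sdiff_inter_self, measure_empty]
        · refine measure_mono_null (Set.inter_subset_inter_left _ Set.sdiff_subset) (step _ (hm3 _)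
            (hξ.2.2.2.2 ⟨_, h1⟩) (hζ.2.2.2.2 ⟨_, h1⟩) Set.inter_subset_left ?_)
          exact measure_mono_null (t := C (v ζ) ∩ e ⁻¹' αᶜ) (fun x hx => ⟨hx.2, hx.1.2⟩)
            (hζ.2.1 h2)
      · exact measure_mono_null (Set.inter_subset_inter_left _ Set.sdiff_subset) (hξ.2.1 h1)
    refine measure_mono_null (fun x hx => ?_) (measure_union_null hatom hdiffuse)
    by_cases h : e x ∈ α
    · exact .inl ⟨hx, h⟩
    · exact .inr ⟨hx, h⟩
  filter_upwards [hGae, ae_add_dirac hc hG hGae] with ξ h1 h2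
  filter_upwards [h2] with x hx hcx
  have hx := hx hcx
  have hU := sec_U_add_dirac (A := A) x ξ
  rw [hsec, hsec]
  refine ae_eq_set.2 ⟨key _ _ hx h1 hU fun Q hQ hQt => ?_, key _ _ h1 hx hU.symm fun Q hQ hQt => ?_⟩
  · rw [Measure.add_apply] at hQt
    exact (ENNReal.add_eq_top.1 hQt).resolve_right (measure_ne_top _ _)
  · rw [Measure.add_apply, hQt, top_add]

/-- The regularised configuration after adding a particle. -/
theorem ae_kap_add_dirac [SigmaFinite lam] [IsProbabilityMeasure μ] (hc : Measurable c)
    (hG : GNZ lam μ c) (hA : IsMax lam μ c A) : ∀ᵐ ξ ∂μ, ∀ᵐ x ∂lam, c (x, ξ) ≠ 0 →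
      ((x, ξ) ∈ U A → kap lam c A (ξ + Measure.dirac x) = kap lam c A ξ + Measure.dirac x) ∧
      ((x, ξ) ∉ U A → c (x, ξ) = ⊤ ∧ kap lam c A (ξ + Measure.dirac x) = kap lam c A ξ) := by
  have hk := kap_eq_ae hc hG hA
  filter_upwards [ae_Inv_add_dirac hc hG hA, hk, ae_add_dirac hc hG hk,
    intensity_zero_or_top hc hG hA] with ξ h1 h2 h3 h4
  filter_upwards [h1, h3, h4] with x h5 h6 h7 hcx
  have hsU := measurableSet_sec (measurableSet_U hA.meas) ξ
  rw [h6 hcx, h2, sec_U_add_dirac, Measure.restrict_congr_set (h5 hcx), Measure.restrict_add]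
  classical
  rw [restrict_dirac' hsU]
  refine ⟨fun h => ?_, fun h => ⟨(h7 h).resolve_left hcx, ?_⟩⟩
  · rw [if_pos (mem_sec.2 h), add_right_comm]
  · rw [if_neg (mt mem_sec.1 h), add_zero]

end

section

theorem card_mul_prod_rpow_le {ι : Type*} {s : Finset ι} (hs : s.Nonempty) (a : ι → ENNReal) :
    s.card * (∏ i ∈ s, a i) ^ (1 / (s.card : ℝ)) ≤ ∑ i ∈ s, a i := by
  by_cases h : ∃ i ∈ s, a i = ⊤
  · rw [ENNReal.sum_eq_top.2 h]
    exact le_top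
  push Not at h
  have hn : (s.card : NNReal) ≠ 0 := by exact_mod_cast hs.card_pos.ne'
  have h1 := NNReal.geom_mean_le_arith_mean_weighted s (fun _ => (s.card : NNReal)⁻¹)
    (fun i => (a i).toNNReal) (by rw [sum_const, nsmul_eq_mul, mul_inv_cancel₀ hn])
  rw [NNReal.finsetProd_rpow, ← Finset.mul_sum, inv_mul_eq_div, le_div_iff₀' (pos_of_ne_zero hn)]
    at h1
  have e1 : ∏ i ∈ s, a i = ((∏ i ∈ s, (a i).toNNReal : NNReal) : ENNReal) := by
    rw [ENNReal.ofNNReal_finsetProd]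
    exact prod_congr rfl fun i hi => (ENNReal.coe_toNNReal (h i hi)).symm
  have e2 : ∑ i ∈ s, a i = ((∑ i ∈ s, (a i).toNNReal : NNReal) : ENNReal) := by
    rw [ENNReal.ofNNReal_finsetSum]
    exact sum_congr rfl fun i hi => (ENNReal.coe_toNNReal (h i hi)).symm
  rw [e1, e2, ← ENNReal.coe_rpow_of_nonneg _ (by positivity), ← ENNReal.coe_natCast,
    ← ENNReal.coe_mul, ENNReal.coe_le_coe]
  simpa using h1

/-- A product of possibly nonmeasurable functions is controlled by their linear integrals. -/
theorem lintegral_mul_prod_le {Ω ι : Type*} [MeasurableSpace Ω] {μ : Measure Ω} [IsFiniteMeasure μ]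
    (s : Finset ι) {f φ : ι → Ω → ENNReal} (hφ : ∀ i, Measurable (φ i))
    (hf : ∀ t : ι → Ω → ENNReal, (∀ i, Measurable (t i)) →
      ∫⁻ ω, ∑ i ∈ s, t i ω * f i ω ∂μ = ∫⁻ ω, ∑ i ∈ s, t i ω * φ i ω ∂μ)
    {F : Ω → ENNReal} (hF : Measurable F) :
    ∫⁻ ω, F ω * ∏ i ∈ s, f i ω ∂μ ≤ ∫⁻ ω, F ω * ∏ i ∈ s, φ i ω ∂μ := by
  classical
  obtain ⟨h, hh, hle, hint⟩ := exists_measurable_le_lintegral_eq μ fun ω => F ω * ∏ i ∈ s, f i ω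
  rw [hint]
  replace hle : ∀ ω, h ω ≤ F ω * ∏ i ∈ s, f i ω := hle
  have hΦ : Measurable fun ω => F ω * ∏ i ∈ s, φ i ω :=
    hF.mul (Finset.measurable_fun_prod _ fun i _ => hφ i)
  have hzero : ∀ i ∈ s, ∀ᵐ ω ∂μ, φ i ω = 0 → h ω = 0 := by
    intro i hi
    let B := {ω | φ i ω = 0} ∩ {ω | h ω = 0}ᶜ
    have hB : MeasurableSet B :=
      (hφ i (measurableSet_singleton 0)).inter (hh (measurableSet_singleton 0)).compl
    let T : Ω → ENNReal := B.indicator fun _ => ⊤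
    have hT : Measurable T := measurable_const.indicator hB
    have h1 := hf (fun j => if j = i then T else 0) fun j => by
      split_ifs
      exacts [hT, measurable_zero]
    have e : ∀ v : ι → Ω → ENNReal, ∀ ω,
        ∑ j ∈ s, (if j = i then T else 0) ω * v j ω = T ω * v i ω := by
      intro v ω
      rw [sum_eq_single i (fun j _ hj => by simp [hj]) (fun h => absurd hi h), if_pos rfl]
    simp only [e] at h1
    have h2 : ∫⁻ ω, T ω * φ i ω ∂μ = 0 := by
      rw [lintegral_eq_zero_of_ae_eq_zero]
      refine .of_forall fun ω => ?_
      by_cases hω : ω ∈ B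
      · simp [show φ i ω = 0 from hω.1]
      · simp [T, hω]
    have h3 : ∫⁻ ω, T ω ∂μ = 0 := by
      refine le_antisymm ((lintegral_mono fun ω => ?_).trans (h1.trans h2).le) zero_le
      by_cases hω : ω ∈ B
      · have : f i ω ≠ 0 := fun h0 => hω.2 (le_antisymm ((hle ω).trans
          (by rw [prod_eq_zero hi h0, mul_zero])) zero_le)
        simp [T, hω, ENNReal.top_mul this]
      · simp [T, hω]
    rw [lintegral_eq_zero_iff hT] at h3
    filter_upwards [h3] with ω h4 h5
    by_contra h6
    have hω : ω ∈ B := ⟨h5, h6⟩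
    simp [T, hω] at h4
  refine lintegral_mono_ae ?_
  rcases s.eq_empty_or_nonempty with rfl | hs
  · exact .of_forall hle
  let B := {ω | F ω * ∏ i ∈ s, φ i ω < h ω} ∩ ⋂ i ∈ s, {ω | φ i ω = 0}ᶜ
  have hB : MeasurableSet B := (measurableSet_lt hΦ hh).inter
    (Finset.measurableSet_biInter _ fun i _ => (hφ i (measurableSet_singleton 0)).compl)
  have hB0 : ∀ ω ∈ B, ∀ i ∈ s, φ i ω ≠ 0 := fun ω hω i hi =>
    Set.mem_iInter₂.1 hω.2 i hi
  have hlt : ∀ ω ∈ B, F ω * ∏ i ∈ s, φ i ω < h ω := fun ω hω => hω.1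
  have hFB : ∀ ω ∈ B, F ω ≠ 0 := fun ω hω h0 => ((hlt ω hω).trans_le (hle ω)).ne (by simp [h0])
  have hB1 : ∀ ω ∈ B, ∀ i ∈ s, φ i ω ≠ ⊤ := by
    intro ω hω i hi h0
    refine ((hlt ω hω).trans_le le_top).ne ?_
    rw [← Finset.mul_prod_erase _ _ hi, h0, ENNReal.top_mul, ENNReal.mul_top (hFB ω hω)]
    exact prod_ne_zero_iff.2 fun j hj => hB0 ω hω j (mem_of_mem_erase hj)
  have hprod0 : ∀ ω ∈ B, ∏ i ∈ s, φ i ω ≠ 0 := fun ω hω => prod_ne_zero_iff.2 (hB0 ω hω)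
  have hFB1 : ∀ ω ∈ B, F ω ≠ ⊤ := by
    intro ω hω h0
    refine ((hlt ω hω).trans_le le_top).ne ?_
    rw [h0, ENNReal.top_mul (hprod0 ω hω)]
  let S : Ω → ENNReal := fun ω =>
    s.card * (h ω * (F ω * ∏ i ∈ s, φ i ω)⁻¹) ^ (1 / (s.card : ℝ))
  have hS : Measurable S := ((hh.mul hΦ.inv).pow_const _).const_mul _
  have h1 := hf (fun i => B.indicator fun ω => (φ i ω)⁻¹) fun i => (hφ i).inv.indicator hB
  have h2 : ∫⁻ ω, ∑ i ∈ s, B.indicator (fun ω => (φ i ω)⁻¹) ω * φ i ω ∂μ =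
      ∫⁻ _ in B, s.card ∂μ := by
    rw [← lintegral_indicator hB]
    refine lintegral_congr fun ω => ?_
    by_cases hω : ω ∈ B
    · simp only [Set.indicator_of_mem hω]
      rw [sum_congr rfl fun i hi => ENNReal.inv_mul_cancel (hB0 ω hω i hi) (hB1 ω hω i hi)]
      simp
    · simp [hω]
  have h3 : ∫⁻ ω in B, S ω ∂μ ≤
      ∫⁻ ω, ∑ i ∈ s, B.indicator (fun ω => (φ i ω)⁻¹) ω * f i ω ∂μ := by
    rw [← lintegral_indicator hB]
    refine lintegral_mono fun ω => ?_
    by_cases hω : ω ∈ B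
    · simp only [Set.indicator_of_mem hω, S]
      refine le_trans ?_ (card_mul_prod_rpow_le hs _)
      gcongr
      calc h ω * (F ω * ∏ i ∈ s, φ i ω)⁻¹
          ≤ (F ω * ∏ i ∈ s, f i ω) * (F ω * ∏ i ∈ s, φ i ω)⁻¹ := by
            gcongr
            exact hle ω
        _ = ∏ i ∈ s, (φ i ω)⁻¹ * f i ω := by
            rw [ENNReal.mul_inv (.inl (hFB ω hω)) (.inl (hFB1 ω hω)), prod_mul_distrib,
              ENNReal.prod_inv_distrib fun i hi j hj _ => .inl (hB0 ω hω i hi), mul_mul_mul_comm,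
              ENNReal.mul_inv_cancel (hFB ω hω) (hFB1 ω hω), one_mul, mul_comm]
    · simp [hω]
  have hμB : μ B = 0 := by
    by_contra hne
    refine absurd (h3.trans (h1.trans h2).le) (not_le.2 ?_)
    refine setLIntegral_strict_mono hB hne hS ?_ (.of_forall fun ω hω => ?_)
    · rw [setLIntegral_const]
      exact ENNReal.mul_ne_top (ENNReal.natCast_ne_top _) (measure_ne_top _ _)
    · have h4 : 1 < h ω * (F ω * ∏ i ∈ s, φ i ω)⁻¹ := by
        rw [← div_eq_mul_inv, ENNReal.lt_div_iff_mul_lt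
          (.inl (mul_ne_zero (hFB ω hω) (hprod0 ω hω))) (.inl (hlt ω hω).ne_top), one_mul]
        exact hlt ω hω
      have h5 := ENNReal.one_lt_rpow h4 (z := 1 / (s.card : ℝ)) (by simpa using hs)
      have h6 := ENNReal.mul_lt_mul_right (Nat.cast_ne_zero.2 hs.card_pos.ne')
        (ENNReal.natCast_ne_top s.card) h5
      rwa [mul_one] at h6
  filter_upwards [measure_eq_zero_iff_ae_notMem.1 hμB,
    (Finset.eventually_all s).2 hzero] with ω h4 h5
  by_cases h6 : ∃ i ∈ s, φ i ω = 0
  · obtain ⟨i, hi, h6⟩ := h6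
    rw [h5 i hi h6]
    exact zero_le
  · push Not at h6
    by_contra h7
    exact h4 ⟨not_le.1 h7, Set.mem_iInter₂.2 h6⟩

variable {E : Type*} [MeasurableSpace E]
variable {lam : Measure E} {μ : Measure (Measure E)} {c : E × Measure E → ENNReal} {A : ℕ → Set E}

theorem lintegral_mul_prod_eq_kap [SigmaFinite lam] [IsProbabilityMeasure μ] (hc : Measurable c)
    (hG : GNZ lam μ c) (hA : IsMax lam μ c A) {ι : Type*} (s : Finset ι)
    {u : ι → E × Measure E → ENNReal} (hu : ∀ i, Measurable (u i)) {F : Measure E → ENNReal}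
    (hF : Measurable F) :
    ∫⁻ ξ, F ξ * ∏ i ∈ s, ∫⁻ x, u i (x, ξ) ∂ξ ∂μ =
      ∫⁻ ξ, F ξ * ∏ i ∈ s, ∫⁻ x, u i (x, ξ) ∂(kap lam c A ξ) ∂μ := by
  have hκ : ∀ i, Measurable fun ξ => ∫⁻ x, u i (x, ξ) ∂(kap lam c A ξ) := fun i =>
    measurable_lintegral_kap lam hc hA.meas measurable_id ((hu i).comp measurable_swap)
  refine le_antisymm (lintegral_mul_prod_le s hκ (fun t ht => ?_) hF) ?_
  · have := lintegral_eq_kap hc hG hA (w := fun p => ∑ i ∈ s, t i p.2 * u i p)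
      (Finset.measurable_fun_sum _ fun i _ => ((ht i).comp measurable_snd).mul (hu i))
    have e : ∀ ν : Measure E, ∀ ξ, ∫⁻ x, ∑ i ∈ s, t i ξ * u i (x, ξ) ∂ν =
        ∑ i ∈ s, t i ξ * ∫⁻ x, u i (x, ξ) ∂ν := by
      intro ν ξ
      have hm : ∀ i, Measurable fun x => u i (x, ξ) := fun i => measurable_section (hu i) ξ
      rw [lintegral_finsetSum _ fun i _ => (hm i).const_mul _]
      exact sum_congr rfl fun i _ => lintegral_const_mul _ (hm i)
    simpa only [e] using this
  · choose g _ hle heq using fun i => exists_minorant hc hG hA (hu i)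
    calc ∫⁻ ξ, F ξ * ∏ i ∈ s, ∫⁻ x, u i (x, ξ) ∂(kap lam c A ξ) ∂μ
        = ∫⁻ ξ, F ξ * ∏ i ∈ s, g i ξ ∂μ := by
          refine lintegral_congr_ae ?_
          filter_upwards [(Finset.eventually_all s).2 fun i _ => heq i] with ξ hξ
          rw [prod_congr rfl hξ]
      _ ≤ _ := lintegral_mono fun ξ => mul_le_mul_right (prod_le_prod' fun i _ => hle i ξ) _

end

section

variable {E : Type*} [MeasurableSpace E]
variable {lam : Measure E} {μ : Measure (Measure E)} {c : E × Measure E → ENNReal} {A : ℕ → Set E}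

theorem ae_kap_eq_zero [SigmaFinite lam] [IsProbabilityMeasure μ] (hc : Measurable c)
    (hG : GNZ lam μ c) (hA : IsMax lam μ c A) {u : E × Measure E → ENNReal} (hu : Measurable u) :
    ∀ᵐ ξ ∂μ, ∀ᵐ x ∂lam, (x, ξ) ∈ Inv c A →
      ∫⁻ y, u (y, ξ) ∂(kap lam c A ξ) = 0 → u (x, ξ) = 0 := by
  filter_upwards [kap_eq_ae hc hG hA] with ξ h1
  by_cases h : ∫⁻ y, u (y, ξ) ∂(kap lam c A ξ) = 0
  · have hC := measurableSet_sec (measurableSet_Inv hA) ξ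
    rw [h1, lintegral_add_measure, add_eq_zero, lintegral_smul_measure, smul_eq_mul] at h
    have h2 := (mul_eq_zero.1 h.2).resolve_left ENNReal.top_ne_zero
    rw [lintegral_eq_zero_iff (measurable_section hu ξ), Filter.EventuallyEq,
      ae_restrict_iff' hC] at h2
    filter_upwards [h2] with x hx h3 _
    exact hx h3
  · exact .of_forall fun x _ h0 => absurd h0 h

theorem ae_prod_kap_add_dirac [SigmaFinite lam] [IsProbabilityMeasure μ] (hc : Measurable c)
    (hG : GNZ lam μ c) (hA : IsMax lam μ c A) {ι : Type*} (s : Finset ι)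
    {u : ι → E × Measure E → ENNReal} (hu : ∀ i, Measurable (u i)) (H : E × Measure E → ENNReal) :
    ∀ᵐ ξ ∂μ, ∀ᵐ x ∂lam,
      H (x, ξ) * (∏ i ∈ s, ∫⁻ y, u i (y, ξ + Measure.dirac x) ∂(kap lam c A (ξ + Measure.dirac x)))
        * c (x, ξ) =
      H (x, ξ) * (∏ i ∈ s, (u i (x, ξ + Measure.dirac x) +
        ∫⁻ y, u i (y, ξ + Measure.dirac x) ∂(kap lam c A ξ))) * c (x, ξ) := by
  obtain ⟨A', h1, h2, h3, -⟩ := exists_vis_kap hG hA (W := fun i : s => u i) fun i => hu i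
  filter_upwards [ae_kap_add_dirac hc hG hA, hA.null A' h1 h2,
    (Finset.eventually_all s).2 fun i _ => ae_kap_eq_zero hc hG hA (hu i)] with ξ h4 h5 h6
  filter_upwards [h4, h5, (Finset.eventually_all s).2 h6] with x h7 h8 h9
  by_cases hcx : c (x, ξ) = 0
  · rw [hcx, mul_zero, mul_zero]
  by_cases hU : (x, ξ) ∈ U A
  · congr 2
    refine prod_congr rfl fun i _ => ?_
    rw [(h7 hcx).1 hU, lintegral_add_measure, lintegral_dirac' _ (measurable_section (hu i) _),
      add_comm]
  · obtain ⟨htop, hk⟩ := (h7 hcx).2 hU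
    have hU' : (x, ξ) ∉ U A' := fun h => hcx (h8 h hU)
    have e : ∀ i ∈ s, ∀ y, u i (y, ξ + Measure.dirac x) = u i (y, ξ) := fun i hi y =>
      eq_of_code_eq (h3 ⟨i, hi⟩) (code_add_dirac h1 hU' y)
    rw [hk, prod_congr rfl fun i hi => lintegral_congr (e i hi),
      prod_congr rfl fun i hi => congrArg₂ (· + ·) (e i hi x) (lintegral_congr (e i hi)), htop]
    have hiff : ∏ i ∈ s, ∫⁻ y, u i (y, ξ) ∂(kap lam c A ξ) = 0 ↔
        ∏ i ∈ s, (u i (x, ξ) + ∫⁻ y, u i (y, ξ) ∂(kap lam c A ξ)) = 0 := by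
      simp only [Finset.prod_eq_zero_iff, add_eq_zero]
      exact exists_congr fun i => and_congr_right fun hi => ⟨fun h => ⟨h9 i hi ⟨hU, htop⟩ h, h⟩,
        fun h => h.2⟩
    by_cases h0 : H (x, ξ) = 0
    · simp [h0]
    by_cases hp : ∏ i ∈ s, ∫⁻ y, u i (y, ξ) ∂(kap lam c A ξ) = 0
    · rw [hp, hiff.1 hp]
    · rw [ENNReal.mul_top (mul_ne_zero h0 hp), ENNReal.mul_top (mul_ne_zero h0 (mt hiff.2 hp))]

end

section

variable {E : Type*} [MeasurableSpace E]
variable {lam : Measure E} {μ : Measure (Measure E)} {c : E × Measure E → ENNReal} {A : ℕ → Set E}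

theorem lintegral_kap_kap [SigmaFinite lam] [IsProbabilityMeasure μ] (hc : Measurable c)
    (hG : GNZ lam μ c) (hA : IsMax lam μ c A) {W : Measure E × E × E → ENNReal}
    (hW : Measurable W) :
    ∫⁻ ξ, ∫⁻ x, ∫⁻ y, W (ξ, x, y) ∂(kap lam c A ξ) ∂(kap lam c A ξ) ∂μ =
      ∫⁻ ξ, ∫⁻ y, ∫⁻ x, W (ξ + Measure.dirac y + Measure.dirac x, x, y) *
        c (x, ξ + Measure.dirac y) * c (y, ξ) ∂lam ∂lam ∂μ +
      ∫⁻ ξ, ∫⁻ x, (U A).indicator (fun p => W (p.2, p.1, p.1)) (x, ξ) ∂(kap lam c A ξ) ∂μ := by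
  classical
  have hU := measurableSet_U hA.meas
  have hD : Measurable ((U A).indicator fun p => W (p.2, p.1, p.1)) :=
    (hW.comp (measurable_snd.prodMk (measurable_fst.prodMk measurable_fst))).indicator hU
  have h1 : Measurable fun p : E × Measure E => ∫⁻ y, W (p.2, p.1, y) ∂(kap lam c A p.2) :=
    measurable_lintegral_kap lam hc hA.meas measurable_snd
      (hW.comp ((measurable_snd.comp measurable_fst).prodMk
        ((measurable_fst.comp measurable_fst).prodMk measurable_snd)))
  have h2 : Measurable fun p : (E × Measure E) × E =>
      W (p.1.2 + Measure.dirac p.2, p.2, p.1.1) * c (p.2, p.1.2) :=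
    (hW.comp ((measurable_add_dirac measurable_snd (measurable_snd.comp measurable_fst)).prodMk
      (measurable_snd.prodMk (measurable_fst.comp measurable_fst)))).mul
      (hc.comp (measurable_snd.prodMk (measurable_snd.comp measurable_fst)))
  have h3 : Measurable fun p : E × Measure E =>
      ∫⁻ x, W (p.2 + Measure.dirac x, x, p.1) * c (x, p.2) ∂lam := h2.lintegral_prod_right'
  have h4 : Measurable fun p : E × Measure E =>
      ∫⁻ y, W (p.2 + Measure.dirac p.1, p.1, y) ∂(kap lam c A p.2) :=
    measurable_lintegral_kap lam hc hA.meas measurable_snd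
      (hW.comp ((measurable_add_dirac (measurable_fst.comp measurable_fst)
        (measurable_snd.comp measurable_fst)).prodMk
        ((measurable_fst.comp measurable_fst).prodMk measurable_snd)))
  calc ∫⁻ ξ, ∫⁻ x, ∫⁻ y, W (ξ, x, y) ∂(kap lam c A ξ) ∂(kap lam c A ξ) ∂μ
      = ∫⁻ ξ, ∫⁻ x, (∫⁻ y, W (ξ + Measure.dirac x, x, y) ∂(kap lam c A (ξ + Measure.dirac x))) *
          c (x, ξ) ∂lam ∂μ := gnz_kap hc hG hA h1
    _ = ∫⁻ ξ, ∫⁻ x, (∫⁻ y, W (ξ + Measure.dirac x, x, y) ∂(kap lam c A ξ)) * c (x, ξ) +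
          (U A).indicator (fun p => W (p.2, p.1, p.1)) (x, ξ + Measure.dirac x) * c (x, ξ)
          ∂lam ∂μ := by
        refine lintegral_congr_ae ?_
        filter_upwards [ae_kap_add_dirac hc hG hA] with ξ h5
        refine lintegral_congr_ae ?_
        filter_upwards [h5] with x h6
        by_cases hcx : c (x, ξ) = 0
        · rw [hcx, mul_zero, mul_zero, mul_zero, add_zero]
        rw [Set.indicator_apply, mem_U_add_dirac, ← add_mul]
        by_cases hx : (x, ξ) ∈ U A
        · rw [(h6 hcx).1 hx, lintegral_add_measure, if_pos hx, lintegral_dirac']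
          exact hW.comp (measurable_const.prodMk (measurable_const.prodMk measurable_id))
        · rw [((h6 hcx).2 hx).2, if_neg hx, add_zero]
    _ = ∫⁻ ξ, ∫⁻ x, (∫⁻ y, W (ξ + Measure.dirac x, x, y) ∂(kap lam c A ξ)) * c (x, ξ) ∂lam ∂μ +
          ∫⁻ ξ, ∫⁻ x, (U A).indicator (fun p => W (p.2, p.1, p.1)) (x, ξ + Measure.dirac x) *
            c (x, ξ) ∂lam ∂μ := by
        have hm := h4.mul hc
        rw [← lintegral_add_left]
        · refine lintegral_congr fun ξ => lintegral_add_left (measurable_section hm ξ) _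
        · exact measurable_lintegral_section lam hm
    _ = _ := by
        rw [← gnz_kap hc hG hA hD]
        congr 1
        calc ∫⁻ ξ, ∫⁻ x, (∫⁻ y, W (ξ + Measure.dirac x, x, y) ∂(kap lam c A ξ)) * c (x, ξ) ∂lam ∂μ
            = ∫⁻ ξ, ∫⁻ y, ∫⁻ x, W (ξ + Measure.dirac x, x, y) * c (x, ξ) ∂lam ∂(kap lam c A ξ)
                ∂μ := by
              refine lintegral_congr fun ξ => ?_
              have := sFinite_kap lam hc hA.meas ξ
              rw [← lintegral_lintegral_swap]
              · refine lintegral_congr fun x => (lintegral_mul_const _ ?_).symm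
                exact hW.comp (measurable_const.prodMk (measurable_const.prodMk measurable_id))
              · exact (h2.comp ((measurable_snd.prodMk measurable_const).prodMk
                  measurable_fst)).aemeasurable
          _ = ∫⁻ ξ, ∫⁻ y, (∫⁻ x, W (ξ + Measure.dirac y + Measure.dirac x, x, y) *
                c (x, ξ + Measure.dirac y) ∂lam) * c (y, ξ) ∂lam ∂μ := gnz_kap hc hG hA h3
          _ = _ := by
              refine lintegral_congr fun ξ => lintegral_congr fun y => ?_
              refine (lintegral_mul_const _ ?_).symm
              exact h2.comp (measurable_prodMk_left (x := (y, ξ + Measure.dirac y)))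

theorem lintegral_kap_kap_swap [SigmaFinite lam] (hc : Measurable c)
    (hA : ∀ i, MeasurableSet (A i)) {W : Measure E × E × E → ENNReal} (hW : Measurable W) :
    ∫⁻ ξ, ∫⁻ x, ∫⁻ y, W (ξ, x, y) ∂(kap lam c A ξ) ∂(kap lam c A ξ) ∂μ =
      ∫⁻ ξ, ∫⁻ x, ∫⁻ y, W (ξ, y, x) ∂(kap lam c A ξ) ∂(kap lam c A ξ) ∂μ := by
  refine lintegral_congr fun ξ => ?_
  have := sFinite_kap lam hc hA ξ
  exact lintegral_lintegral_swap (hW.comp measurable_prodMk_left).aemeasurable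

theorem lintegral_two_swap_of_ne_top [SigmaFinite lam] [IsProbabilityMeasure μ] (hc : Measurable c)
    (hG : GNZ lam μ c) (hA : IsMax lam μ c A) {W : Measure E × E × E → ENNReal}
    (hW : Measurable W)
    (h : ∫⁻ ξ, ∫⁻ x, (U A).indicator (fun p => W (p.2, p.1, p.1)) (x, ξ) ∂(kap lam c A ξ) ∂μ ≠ ⊤) :
    ∫⁻ ξ, ∫⁻ y, ∫⁻ x, W (ξ + Measure.dirac y + Measure.dirac x, x, y) *
        c (x, ξ + Measure.dirac y) * c (y, ξ) ∂lam ∂lam ∂μ =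
      ∫⁻ ξ, ∫⁻ x, ∫⁻ y, W (ξ + Measure.dirac x + Measure.dirac y, x, y) *
        c (y, ξ + Measure.dirac x) * c (x, ξ) ∂lam ∂lam ∂μ := by
  have hW' : Measurable fun p : Measure E × E × E => W (p.1, p.2.2, p.2.1) :=
    hW.comp (measurable_fst.prodMk (measurable_snd.comp measurable_snd |>.prodMk
      (measurable_fst.comp measurable_snd)))
  have h1 := lintegral_kap_kap hc hG hA hW
  rw [lintegral_kap_kap_swap hc hA.meas hW] at h1
  exact (ENNReal.add_left_inj h).1 (h1.symm.trans (lintegral_kap_kap hc hG hA hW'))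

theorem exists_preimage_add_dirac_dirac {S : Set (Measure E × E × E)} (hS : MeasurableSet S) :
    ∃ S', MeasurableSet S' ∧
      (fun p : Measure E × E × E => (p.1 + Measure.dirac p.2.1 + Measure.dirac p.2.2, p.2)) ⁻¹' S' =
        S := by
  let Ψ : Measure E × E × E → Measure E × E × E := fun p =>
    (p.1 + Measure.dirac p.2.1 + Measure.dirac p.2.2, p.2)
  have hΨ : Measurable[MeasurableSpace.comap Ψ inferInstance] Ψ := comap_measurable Ψ
  have hid : Measurable[MeasurableSpace.comap Ψ inferInstance] (id : Measure E × E × E → _) := by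
    have hsnd : Measurable[MeasurableSpace.comap Ψ inferInstance] fun p => (Ψ p).2 :=
      measurable_snd.comp hΨ
    refine Measurable.prodMk (Measure.measurable_of_measurable_coe _ fun B hB => ?_) hsnd
    have hind : Measurable (B.indicator (1 : E → ENNReal)) := measurable_one.indicator hB
    have hm : Measurable fun q : Measure E × E × E =>
        q.1 B - B.indicator (1 : E → ENNReal) q.2.2 - B.indicator (1 : E → ENNReal) q.2.1 :=
      (((Measure.measurable_coe hB).comp measurable_fst).sub
        (hind.comp (measurable_snd.comp measurable_snd))).sub
        (hind.comp (measurable_fst.comp measurable_snd))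
    convert hm.comp hΨ using 1
    funext p
    have hfin : ∀ x, B.indicator (1 : E → ENNReal) x ≠ ⊤ := fun x => by
      rw [← Measure.dirac_apply' x hB]
      exact measure_ne_top _ _
    simp only [Function.comp_apply, Ψ, Measure.add_apply, Measure.dirac_apply' _ hB]
    rw [ENNReal.add_sub_cancel_right (hfin _), ENNReal.add_sub_cancel_right (hfin _)]
  exact hid hS

end

section

variable {E : Type*} [MeasurableSpace E]
variable {lam : Measure E} {μ : Measure (Measure E)} {c : E × Measure E → ENNReal} {A : ℕ → Set E}

theorem kap_V_le (hA : ∀ i, MeasurableSet (A i)) (n : ℕ) (ξ : Measure E) :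
    kap lam c A ξ (sec (V A n) ξ) ≤ n.unpair.2 := by
  have hV := measurableSet_sec (measurableSet_V hA n) ξ
  have hsub : sec (V A n) ξ ⊆ sec (U A) ξ := fun x hx => Set.mem_iUnion.2 ⟨n, hx⟩
  rw [kap_apply ξ hV, Set.inter_eq_left.2 hsub, ← Set.sdiff_eq, Set.sdiff_eq_empty.2 hsub,
    setLIntegral_empty, add_zero]
  by_cases h : ξ (A n.unpair.1) ≤ n.unpair.2
  · exact (measure_mono fun x hx => hx.1).trans h
  · rw [measure_mono_null (t := ∅) (fun x hx => h hx.2) measure_empty]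
    exact zero_le

theorem lintegral_three_eq [SFinite lam] [SFinite μ] {g : Measure E × E × E → ENNReal}
    (hg : Measurable g) :
    ∫⁻ ξ, ∫⁻ x, ∫⁻ y, g (ξ, x, y) ∂lam ∂lam ∂μ = ∫⁻ p, g p ∂(μ.prod (lam.prod lam)) := by
  rw [lintegral_prod _ hg.aemeasurable]
  exact lintegral_congr fun ξ => (lintegral_prod _ (hg.comp measurable_prodMk_left).aemeasurable).symm

theorem lintegral_three_swap [SFinite lam] {g : Measure E × E × E → ENNReal}
    (hg : Measurable g) :
    ∫⁻ ξ, ∫⁻ y, ∫⁻ x, g (ξ, x, y) ∂lam ∂lam ∂μ = ∫⁻ ξ, ∫⁻ x, ∫⁻ y, g (ξ, x, y) ∂lam ∂lam ∂μ :=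
  lintegral_congr fun ξ =>
    (lintegral_lintegral_swap (f := fun x y => g (ξ, x, y))
      (hg.comp measurable_prodMk_left).aemeasurable).symm

/-- Two-particle intensities do not depend on the order of insertion. -/
theorem intensity_comm [SigmaFinite lam] [IsProbabilityMeasure μ] (hc : Measurable c)
    (hG : GNZ lam μ c) : ∀ᵐ ξ ∂μ, ∀ᵐ x ∂lam, ∀ᵐ y ∂lam,
      c (y, ξ + Measure.dirac x) * c (x, ξ) = c (x, ξ + Measure.dirac y) * c (y, ξ) := by
  obtain ⟨A, hA⟩ := exists_isMax lam μ hc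
  let Ψ : Measure E × E × E → Measure E × E × E := fun p =>
    (p.1 + Measure.dirac p.2.1 + Measure.dirac p.2.2, p.2)
  let a : Measure E × E × E → ENNReal := fun p =>
    c (p.2.2, p.1 + Measure.dirac p.2.1) * c (p.2.1, p.1)
  let b : Measure E × E × E → ENNReal := fun p =>
    c (p.2.1, p.1 + Measure.dirac p.2.2) * c (p.2.2, p.1)
  have mx : Measurable fun p : Measure E × E × E => p.2.1 := measurable_fst.comp measurable_snd
  have my : Measurable fun p : Measure E × E × E => p.2.2 := measurable_snd.comp measurable_snd
  have mξ : Measurable fun p : Measure E × E × E => p.1 := measurable_fst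
  have hΨ : Measurable Ψ :=
    (measurable_add_dirac my (measurable_add_dirac mx mξ)).prodMk measurable_snd
  have ha : Measurable a :=
    (hc.comp (my.prodMk (measurable_add_dirac mx mξ))).mul (hc.comp (mx.prodMk mξ))
  have hb : Measurable b :=
    (hc.comp (mx.prodMk (measurable_add_dirac my mξ))).mul (hc.comp (my.prodMk mξ))
  have key : ∀ D, MeasurableSet D →
      ∫⁻ ξ, ∫⁻ x, (U A).indicator (fun p => D.indicator (1 : E × Measure E → ENNReal) p) (x, ξ)
        ∂(kap lam c A ξ) ∂μ ≠ ⊤ →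
      ∀ᵐ p ∂(μ.prod (lam.prod lam)), ((Ψ p).2.1, (Ψ p).1) ∈ D → a p = b p := by
    intro D hD hfin
    let D' : Set (Measure E × E × E) := {p | (p.2.1, p.1) ∈ D}
    have hD' : MeasurableSet D' := (mx.prodMk mξ) hD
    have hDD : MeasurableSet (Ψ ⁻¹' D') := hΨ hD'
    have hae : (Ψ ⁻¹' D').indicator a =ᵐ[μ.prod (lam.prod lam)] (Ψ ⁻¹' D').indicator b := by
      refine ae_eq_of_forall_setLIntegral_eq_of_sigmaFinite (ha.indicator hDD) (hb.indicator hDD)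
        fun S hS _ => ?_
      obtain ⟨S', hS', rfl⟩ := exists_preimage_add_dirac_dirac hS
      let W : Measure E × E × E → ENNReal := (S' ∩ D').indicator 1
      have hW : Measurable W := measurable_one.indicator (hS'.inter hD')
      have e : ∀ f : Measure E × E × E → ENNReal,
          ∫⁻ p in Ψ ⁻¹' S', (Ψ ⁻¹' D').indicator f p ∂(μ.prod (lam.prod lam)) =
            ∫⁻ p, W (Ψ p) * f p ∂(μ.prod (lam.prod lam)) := by
        intro f
        rw [← lintegral_indicator hS]
        refine lintegral_congr fun p => ?_
        rw [Set.indicator_indicator, ← Set.preimage_inter]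
        by_cases hp : Ψ p ∈ S' ∩ D'
        · rw [Set.indicator_of_mem (Set.mem_preimage.2 hp)]
          simp [W, hp]
        · rw [Set.indicator_of_notMem (mt Set.mem_preimage.1 hp)]
          simp [W, hp]
      have hWa := (hW.comp hΨ).mul ha
      have hWb := (hW.comp hΨ).mul hb
      refine (e a).trans (Eq.trans ?_ (e b).symm)
      refine (lintegral_three_eq hWa).symm.trans (Eq.trans ?_ (lintegral_three_eq hWb))
      refine Eq.trans ?_ (lintegral_three_swap hWb)
      refine Eq.trans ?_ ((lintegral_two_swap_of_ne_top hc hG hA hW ?_).symm.trans ?_)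
      · simp only [Pi.mul_apply, Function.comp_apply, Ψ, a, mul_assoc]
      · refine ne_top_of_le_ne_top hfin (lintegral_mono fun ξ => lintegral_mono fun x => ?_)
        refine Set.indicator_le_indicator ?_
        by_cases hx : (ξ, x, x) ∈ S' ∩ D'
        · simp only [W, Set.indicator_of_mem hx]
          rw [Set.indicator_of_mem (show (x, ξ) ∈ D from hx.2)]
          rfl
        · simp [W, hx]
      · simp only [Pi.mul_apply, Function.comp_apply, Ψ, b, mul_assoc]
        refine lintegral_congr fun ξ => lintegral_congr fun y => lintegral_congr fun x => ?_
        rw [add_right_comm]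
    filter_upwards [hae] with p hp hpD
    have hpD' : p ∈ Ψ ⁻¹' D' := hpD
    rwa [Set.indicator_of_mem hpD', Set.indicator_of_mem hpD'] at hp
  have hUc := key (U A)ᶜ (measurableSet_U hA.meas).compl (by
    have e : ∀ p, (U A).indicator (fun p => (U A)ᶜ.indicator (1 : E × Measure E → ENNReal) p) p = 0 :=
      fun p => by by_cases hp : p ∈ U A <;> simp [hp]
    simp only [e, lintegral_zero]
    exact ENNReal.zero_ne_top)
  have hV : ∀ n, ∀ᵐ p ∂(μ.prod (lam.prod lam)), ((Ψ p).2.1, (Ψ p).1) ∈ V A n → a p = b p := by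
    intro n
    refine key _ (measurableSet_V hA.meas n) (ne_top_of_le_ne_top (ENNReal.natCast_ne_top n.unpair.2)
      ((lintegral_mono fun ξ => ?_ ).trans_eq (by simp : ∫⁻ _, (n.unpair.2 : ENNReal) ∂μ = _)))
    refine le_trans (lintegral_mono fun x => Set.indicator_le_self _ _ _) ?_
    refine le_trans (le_of_eq ?_) (kap_V_le (lam := lam) (c := c) hA.meas n ξ)
    rw [← lintegral_indicator_one (measurableSet_sec (measurableSet_V hA.meas n) ξ)]
    rfl
  have hall : ∀ᵐ p ∂(μ.prod (lam.prod lam)), a p = b p := by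
    filter_upwards [hUc, ae_all_iff.2 hV] with p h1 h2
    by_cases hp : ((Ψ p).2.1, (Ψ p).1) ∈ U A
    · obtain ⟨n, hn⟩ := Set.mem_iUnion.1 hp
      exact h2 n hn
    · exact h1 hp
  filter_upwards [Measure.ae_ae_of_ae_prod hall] with ξ hξ
  exact Measure.ae_ae_of_ae_prod hξ

end

section

universe u₀
variable {E : Type u₀} [MeasurableSpace E]
variable {lam : Measure E} {μ : Measure (Measure E)} {c : E × Measure E → ENNReal}
variable {ι : Type*}

/-- Successive insertion of one particle for each block of a list of blocks. -/
noncomputable def insertion (lam : Measure E) (c : E × Measure E → ENNReal)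
    (u : ι → E × Measure E → ENNReal) :
    List (Finset ι) → (Measure E → ENNReal) → Measure E → ENNReal
  | [], F, ξ => F ξ
  | B :: L, F, ξ => ∫⁻ x, c (x, ξ) *
      insertion lam c u L (fun η => F η * ∏ i ∈ B, u i (x, η)) (ξ + Measure.dirac x) ∂lam

theorem measurable_insertion [SFinite lam] (hc : Measurable c) (L : List (Finset ι))
    {α : Type u₀} [MeasurableSpace α] {u : α → ι → E × Measure E → ENNReal}
    (hu : ∀ i, Measurable fun q : α × E × Measure E => u q.1 i q.2)
    {F : α → Measure E → ENNReal} (hF : Measurable fun q : α × Measure E => F q.1 q.2)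
    {g : α → Measure E} (hg : Measurable g) :
    Measurable fun a => insertion lam c (u a) L (F a) (g a) := by
  induction L generalizing α with
  | nil => exact hF.comp (measurable_id.prodMk hg)
  | cons B L ih =>
    have hg' : Measurable fun q : α × E => g q.1 + Measure.dirac q.2 :=
      measurable_add_dirac measurable_snd (hg.comp measurable_fst)
    have h1 : ∀ i, Measurable fun q : (α × E) × E × Measure E => u q.1.1 i q.2 := fun i =>
      (hu i).comp ((measurable_fst.comp measurable_fst).prodMk measurable_snd)
    have h2 : Measurable fun q : (α × E) × Measure E =>
        F q.1.1 q.2 * ∏ i ∈ B, u q.1.1 i (q.1.2, q.2) :=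
      (hF.comp ((measurable_fst.comp measurable_fst).prodMk measurable_snd)).mul
        (Finset.measurable_fun_prod _ fun i _ => (hu i).comp
          ((measurable_fst.comp measurable_fst).prodMk
            ((measurable_snd.comp measurable_fst).prodMk measurable_snd)))
    have h3 : Measurable fun q : α × E => c (q.2, g q.1) *
        insertion lam c (u q.1) L (fun η => F q.1 η * ∏ i ∈ B, u q.1 i (q.2, η))
          (g q.1 + Measure.dirac q.2) :=
      (hc.comp (measurable_snd.prodMk (hg.comp measurable_fst))).mul
        (ih (u := fun q => u q.1) (F := fun q η => F q.1 η * ∏ i ∈ B, u q.1 i (q.2, η)) h1 h2 hg')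
    exact h3.lintegral_prod_right'

theorem insertion_perm [SigmaFinite lam] [IsProbabilityMeasure μ] (hc : Measurable c)
    (hG : GNZ lam μ c) {u : ι → E × Measure E → ENNReal} (hu : ∀ i, Measurable (u i))
    {L L' : List (Finset ι)} (h : L.Perm L') : ∀ᵐ ξ ∂μ, ∀ F : Measure E → ENNReal, Measurable F →
      insertion lam c u L F ξ = insertion lam c u L' F ξ := by
  induction h with
  | nil => exact .of_forall fun _ _ _ => rfl
  | trans _ _ ih1 ih2 =>
    filter_upwards [ih1, ih2] with ξ h1 h2 F hF
    rw [h1 F hF, h2 F hF]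
  | cons B _ ih =>
    filter_upwards [ae_add_dirac hc hG ih] with ξ h1 F hF
    refine lintegral_congr_ae ?_
    filter_upwards [h1] with x hx
    by_cases hcx : c (x, ξ) = 0
    · rw [hcx, zero_mul, zero_mul]
    · rw [hx hcx]
      exact hF.mul (Finset.measurable_fun_prod _ fun i _ => (hu i).comp measurable_prodMk_left)
  | swap B C L =>
    filter_upwards [intensity_comm hc hG] with ξ h1 F hF
    let T : E × E → ENNReal := fun p => insertion lam c u L
      (fun η => F η * (∏ i ∈ C, u i (p.1, η)) * ∏ i ∈ B, u i (p.2, η))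
      (ξ + Measure.dirac p.1 + Measure.dirac p.2)
    have mu : ∀ i, ∀ {v : (E × E) × Measure E → E}, Measurable v →
        Measurable fun q : (E × E) × Measure E => u i (v q, q.2) := fun i v hv =>
      (hu i).comp (hv.prodMk measurable_snd)
    have hT : Measurable T := by
      refine measurable_insertion (u := fun _ => u) hc L (fun i => (hu i).comp measurable_snd) ?_
        (measurable_add_dirac measurable_snd (measurable_add_dirac measurable_fst measurable_const))
      exact ((hF.comp measurable_snd).mul (Finset.measurable_fun_prod _ fun i _ =>
        mu i (measurable_fst.comp measurable_fst))).mul (Finset.measurable_fun_prod _ fun i _ =>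
        mu i (measurable_snd.comp measurable_fst))
    have hTx : ∀ x, Measurable fun y => T (x, y) := fun x => hT.comp measurable_prodMk_left
    have hTy : ∀ y, Measurable fun x => T (x, y) := fun y => hT.comp measurable_prodMk_right
    have hcd : Measurable fun p : E × E => c (p.2, ξ + Measure.dirac p.1) :=
      hc.comp (measurable_snd.prodMk (measurable_add_dirac measurable_fst measurable_const))
    have hcx : ∀ x, Measurable fun y => c (y, ξ + Measure.dirac x) := fun x =>
      hcd.comp measurable_prodMk_left
    have hc1 : Measurable fun x => c (x, ξ) := hc.comp measurable_prodMk_right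
    have e1 : insertion lam c u (C :: B :: L) F ξ =
        ∫⁻ x, ∫⁻ y, c (y, ξ + Measure.dirac x) * c (x, ξ) * T (x, y) ∂lam ∂lam := by
      refine lintegral_congr fun x => ?_
      refine (lintegral_const_mul _ ((hcx x).mul (hTx x))).symm.trans ?_
      refine lintegral_congr fun y => ?_
      rw [Pi.mul_apply, mul_left_comm, mul_assoc]
    have e2 : insertion lam c u (B :: C :: L) F ξ =
        ∫⁻ y, ∫⁻ x, c (x, ξ + Measure.dirac y) * c (y, ξ) * T (x, y) ∂lam ∂lam := by
      have hT' : ∀ x y, insertion lam c u L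
          (fun η => F η * (∏ i ∈ B, u i (y, η)) * ∏ i ∈ C, u i (x, η))
          (ξ + Measure.dirac y + Measure.dirac x) = T (x, y) := fun x y => by
        simp only [T, mul_right_comm, add_right_comm]
      simp only [insertion, hT']
      refine lintegral_congr fun y => ?_
      refine (lintegral_const_mul _ ((hcx y).mul (hTy y))).symm.trans ?_
      refine lintegral_congr fun x => ?_
      rw [Pi.mul_apply, mul_left_comm, mul_assoc]
    rw [e1, e2, lintegral_lintegral_swap]
    · refine lintegral_congr_ae ?_
      filter_upwards [h1] with x hx
      refine lintegral_congr_ae ?_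
      filter_upwards [hx] with y hy
      rw [hy]
    · exact ((hcd.mul (hc1.comp measurable_fst)).mul hT).aemeasurable

theorem lintegral_insertion_eq_append [SigmaFinite lam] (hc : Measurable c)
    {u : ι → E × Measure E → ENNReal} (hu : ∀ i, Measurable (u i)) (B : Finset ι)
    (L : List (Finset ι)) {F : Measure E → ENNReal} (hF : Measurable F) (ξ : Measure E) :
    ∫⁻ x, insertion lam c (fun i p => u i (p.1, p.2 + Measure.dirac x)) L
      (fun η => F (η + Measure.dirac x) * (∏ i ∈ B, u i (x, η + Measure.dirac x)) * c (x, η)) ξ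
      ∂lam = insertion lam c u (L ++ [B]) F ξ := by
  induction L generalizing F ξ with
  | nil => exact lintegral_congr fun x => mul_comm _ _
  | cons C L ih =>
    have hF' : ∀ y, Measurable fun η => F η * ∏ i ∈ C, u i (y, η) := fun y =>
      hF.mul (Finset.measurable_fun_prod _ fun i _ => (hu i).comp measurable_prodMk_left)
    let N : E → E → ENNReal := fun x y => insertion lam c
      (fun i q => u i (q.1, q.2 + Measure.dirac x)) L
      (fun η => F (η + Measure.dirac x) * (∏ i ∈ C, u i (y, η + Measure.dirac x)) *
        (∏ i ∈ B, u i (x, η + Measure.dirac x)) * c (x, η)) (ξ + Measure.dirac y)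
    have hN : Measurable (Function.uncurry N) := by
      have m1 : Measurable fun q : (E × E) × Measure E => q.2 + Measure.dirac q.1.1 :=
        measurable_add_dirac (measurable_fst.comp measurable_fst) measurable_snd
      have m2 : ∀ i, Measurable fun q : (E × E) × E × Measure E =>
          u i (q.2.1, q.2.2 + Measure.dirac q.1.1) := fun i =>
        (hu i).comp ((measurable_fst.comp measurable_snd).prodMk
          (measurable_add_dirac (measurable_fst.comp measurable_fst)
            (measurable_snd.comp measurable_snd)))
      have m3 : Measurable fun q : (E × E) × Measure E => F (q.2 + Measure.dirac q.1.1) *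
          (∏ i ∈ C, u i (q.1.2, q.2 + Measure.dirac q.1.1)) *
          (∏ i ∈ B, u i (q.1.1, q.2 + Measure.dirac q.1.1)) * c (q.1.1, q.2) :=
        (((hF.comp m1).mul (Finset.measurable_fun_prod _ fun i _ =>
          (hu i).comp ((measurable_snd.comp measurable_fst).prodMk m1))).mul
          (Finset.measurable_fun_prod _ fun i _ =>
            (hu i).comp ((measurable_fst.comp measurable_fst).prodMk m1))).mul
          (hc.comp ((measurable_fst.comp measurable_fst).prodMk measurable_snd))
      have m4 : Measurable fun p : E × E => ξ + Measure.dirac p.2 :=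
        measurable_add_dirac measurable_snd measurable_const
      exact measurable_insertion (lam := lam) (α := E × E)
        (u := fun p i q => u i (q.1, q.2 + Measure.dirac p.1))
        (F := fun p η => F (η + Measure.dirac p.1) * (∏ i ∈ C, u i (p.2, η + Measure.dirac p.1)) *
          (∏ i ∈ B, u i (p.1, η + Measure.dirac p.1)) * c (p.1, η)) hc L
        (g := fun p => ξ + Measure.dirac p.2) m2 m3 m4
    have e1 : ∀ x, insertion lam c (fun i p => u i (p.1, p.2 + Measure.dirac x)) (C :: L)
        (fun η => F (η + Measure.dirac x) * (∏ i ∈ B, u i (x, η + Measure.dirac x)) * c (x, η)) ξ =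
        ∫⁻ y, c (y, ξ) * N x y ∂lam := by
      intro x
      simp only [insertion, N]
      refine lintegral_congr fun y => ?_
      congr 2
      funext η
      ring
    have e2 : insertion lam c u (C :: L ++ [B]) F ξ = ∫⁻ y, c (y, ξ) * ∫⁻ x, N x y ∂lam ∂lam := by
      simp only [List.cons_append, insertion]
      refine lintegral_congr fun y => ?_
      rw [← ih (hF' y)]
    rw [e2]
    simp only [e1]
    clear_value N
    have hcN : Measurable (Function.uncurry fun x y => c (y, ξ) * N x y) :=
      (hc.comp (measurable_snd.prodMk measurable_const)).mul hN
    rw [lintegral_lintegral_swap hcN.aemeasurable]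
    refine lintegral_congr fun y => ?_
    exact lintegral_const_mul _ (hN.comp measurable_prodMk_right)

end

section

variable {ι : Type*} [DecidableEq ι]

theorem sum_finpartition_insert {M : Type*} [AddCommMonoid M] {a : ι} {s : Finset ι} (ha : a ∉ s)
    (f : Finset (Finset ι) → M) :
    ∑ t ∈ s.powerset, ∑ P : Finpartition (s \ t), f (insert (insert a t) P.parts) =
      ∑ Q : Finpartition (insert a s), f Q.parts := by
  rw [Finset.sum_sigma']
  have hnot : ∀ {t : Finset ι} (P : Finpartition (s \ t)) {B : Finset ι}, a ∈ B → B ∉ P.parts :=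
    fun P B hB h => ha (Finset.mem_sdiff.1 (P.le h hB)).1
  refine Finset.sum_bij (fun x hx => x.2.extend (b := insert a x.1) (c := insert a s)
    (Finset.insert_ne_empty _ _) ?_ ?_) (fun _ _ => Finset.mem_univ _) ?_ ?_ ?_
  · rw [Finset.disjoint_insert_right]
    exact ⟨fun h => ha (Finset.mem_sdiff.1 h).1, Finset.sdiff_disjoint⟩
  · have hts : x.1 ⊆ s := Finset.mem_powerset.1 (Finset.mem_sigma.1 hx).1
    rw [Finset.sup_eq_union, Finset.union_insert, Finset.sdiff_union_of_subset hts]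
  · rintro ⟨t, P⟩ hx ⟨t', P'⟩ hx' h
    have hat : a ∉ t := fun h => ha (Finset.mem_powerset.1 (Finset.mem_sigma.1 hx).1 h)
    have hat' : a ∉ t' := fun h => ha (Finset.mem_powerset.1 (Finset.mem_sigma.1 hx').1 h)
    have hp : insert (insert a t) P.parts = insert (insert a t') P'.parts :=
      congrArg Finpartition.parts h
    have htt : insert a t = insert a t' := by
      have h1 : insert a t ∈ insert (insert a t') P'.parts := hp ▸ Finset.mem_insert_self _ _
      exact (Finset.mem_insert.1 h1).resolve_right (hnot P' (Finset.mem_insert_self _ _))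
    obtain rfl : t = t' := by
      rw [← Finset.erase_insert hat, htt, Finset.erase_insert hat']
    have hPP : P = P' := by
      ext1
      rw [← Finset.erase_insert (hnot P (Finset.mem_insert_self a t)), hp,
        Finset.erase_insert (hnot P' (Finset.mem_insert_self a t))]
    rw [hPP]
  · intro Q _
    have haS : a ∈ insert a s := Finset.mem_insert_self _ _
    have hB : Q.part a ∈ Q.parts := Q.part_mem.2 haS
    have haB : a ∈ Q.part a := Q.mem_part haS
    let t := (Q.part a).erase a
    have ht : t ⊆ s := by
      intro i hi
      have := Q.le hB (Finset.mem_of_mem_erase hi)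
      exact (Finset.mem_insert.1 this).resolve_left (Finset.ne_of_mem_erase hi)
    have hst : (Q.parts.erase (Q.part a)).sup id = s \ t := by
      ext i
      rw [Finset.mem_sup, Finset.mem_sdiff]
      constructor
      · rintro ⟨C, hC, hi⟩
        have hC' := Finset.mem_of_mem_erase hC
        have hiB : i ∉ Q.part a := fun h =>
          Finset.ne_of_mem_erase hC (Q.eq_of_mem_parts hC' hB hi h)
        refine ⟨(Finset.mem_insert.1 (Q.le hC' hi)).resolve_left ?_,
          fun h => hiB (Finset.mem_of_mem_erase h)⟩
        rintro rfl
        exact hiB haB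
      · rintro ⟨hi, hit⟩
        have hiS : i ∈ insert a s := Finset.mem_insert_of_mem hi
        refine ⟨Q.part i, Finset.mem_erase.2 ⟨fun h => hit ?_, Q.part_mem.2 hiS⟩, Q.mem_part hiS⟩
        refine Finset.mem_erase.2 ⟨?_, h ▸ Q.mem_part hiS⟩
        rintro rfl
        exact ha hi
    let P : Finpartition (s \ t) :=
      { parts := Q.parts.erase (Q.part a)
        supIndep := Q.supIndep.subset (Finset.erase_subset _ _)
        sup_parts := hst
        bot_notMem := fun h => Q.bot_notMem (Finset.mem_of_mem_erase h) }
    refine ⟨⟨t, P⟩, Finset.mem_sigma.2 ⟨Finset.mem_powerset.2 ht, Finset.mem_univ _⟩, ?_⟩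
    ext1
    change insert (insert a ((Q.part a).erase a)) (Q.parts.erase (Q.part a)) = Q.parts
    rw [Finset.insert_erase haB, Finset.insert_erase hB]
  · intro x _
    rfl

end

section

universe u₀
variable {E : Type u₀} [MeasurableSpace E]
variable {lam : Measure E} {μ : Measure (Measure E)} {c : E × Measure E → ENNReal} {A : ℕ → Set E}
variable {ι : Type*} [DecidableEq ι]

theorem lintegral_mul_prod_kap_insert [SigmaFinite lam] [IsProbabilityMeasure μ] (hc : Measurable c)
    (hG : GNZ lam μ c) (hA : IsMax lam μ c A) {a : ι} {s : Finset ι} (ha : a ∉ s)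
    {u : ι → E × Measure E → ENNReal} (hu : ∀ i, Measurable (u i))
    {F : Measure E → ENNReal} (hF : Measurable F) :
    ∫⁻ ξ, F ξ * ∏ i ∈ insert a s, ∫⁻ x, u i (x, ξ) ∂(kap lam c A ξ) ∂μ =
      ∑ t ∈ s.powerset, ∫⁻ x, ∫⁻ ξ, (F (ξ + Measure.dirac x) *
        (∏ i ∈ insert a t, u i (x, ξ + Measure.dirac x)) * c (x, ξ)) *
        ∏ i ∈ s \ t, ∫⁻ y, u i (y, ξ + Measure.dirac x) ∂(kap lam c A ξ) ∂μ ∂lam := by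
  have hk : ∀ i, Measurable fun ξ => ∫⁻ x, u i (x, ξ) ∂(kap lam c A ξ) := fun i =>
    measurable_lintegral_kap lam hc hA.meas measurable_id
      (f := fun q => u i (q.2, q.1)) ((hu i).comp measurable_swap)
  have hd : Measurable fun p : E × Measure E => p.2 + Measure.dirac p.1 :=
    measurable_add_dirac measurable_fst measurable_snd
  have hud : ∀ i, Measurable fun p : E × Measure E => u i (p.1, p.2 + Measure.dirac p.1) :=
    fun i => (hu i).comp (measurable_fst.prodMk hd)
  have hkd : ∀ i, Measurable fun p : E × Measure E =>
      ∫⁻ y, u i (y, p.2 + Measure.dirac p.1) ∂(kap lam c A p.2) := fun i =>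
    measurable_lintegral_kap lam hc hA.meas measurable_snd
      (f := fun q : (E × Measure E) × E => u i (q.2, q.1.2 + Measure.dirac q.1.1))
      ((hu i).comp (measurable_snd.prodMk (hd.comp measurable_fst)))
  have hw : Measurable fun p : E × Measure E =>
      (F p.2 * ∏ i ∈ s, ∫⁻ y, u i (y, p.2) ∂(kap lam c A p.2)) * u a p :=
    ((hF.comp measurable_snd).mul (Finset.measurable_fun_prod _ fun i _ =>
      (hk i).comp measurable_snd)).mul (hu a)
  let T : Finset ι → E × Measure E → ENNReal := fun t p => (F (p.2 + Measure.dirac p.1) *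
        (∏ i ∈ insert a t, u i (p.1, p.2 + Measure.dirac p.1)) * c p) *
        ∏ i ∈ s \ t, ∫⁻ y, u i (y, p.2 + Measure.dirac p.1) ∂(kap lam c A p.2)
  have hT : ∀ t, Measurable (T t) := fun t =>
    (((hF.comp hd).mul (Finset.measurable_fun_prod _ fun i _ => hud i)).mul hc).mul
      (Finset.measurable_fun_prod _ fun i _ => hkd i)
  calc _ = ∫⁻ ξ, ∫⁻ x, (F ξ * ∏ i ∈ s, ∫⁻ y, u i (y, ξ) ∂(kap lam c A ξ)) * u a (x, ξ)
          ∂(kap lam c A ξ) ∂μ := by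
        refine lintegral_congr fun ξ => ?_
        rw [lintegral_const_mul _ (measurable_section (hu a) ξ), Finset.prod_insert ha,
          mul_left_comm, mul_comm]
    _ = ∫⁻ ξ, ∫⁻ x, ∑ t ∈ s.powerset, T t (x, ξ) ∂lam ∂μ := by
        rw [gnz_kap hc hG hA hw]
        refine lintegral_congr_ae ?_
        filter_upwards [ae_prod_kap_add_dirac hc hG hA s hu
          fun p => F (p.2 + Measure.dirac p.1) * u a (p.1, p.2 + Measure.dirac p.1)] with ξ hξ
        refine lintegral_congr_ae ?_
        filter_upwards [hξ] with x hx
        rw [mul_right_comm (F _), hx, Finset.prod_add, Finset.mul_sum, Finset.sum_mul]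
        refine Finset.sum_congr rfl fun t ht => ?_
        have hat : a ∉ t := fun h => ha (Finset.mem_powerset.1 ht h)
        simp only [T]
        rw [Finset.prod_insert hat]
        ring
    _ = ∑ t ∈ s.powerset, ∫⁻ ξ, ∫⁻ x, T t (x, ξ) ∂lam ∂μ := by
        have h1 : ∀ ξ, ∫⁻ x, ∑ t ∈ s.powerset, T t (x, ξ) ∂lam =
            ∑ t ∈ s.powerset, ∫⁻ x, T t (x, ξ) ∂lam := fun ξ =>
          lintegral_finsetSum _ fun t _ => measurable_section (hT t) ξ
        simp only [h1]
        exact lintegral_finsetSum _ fun t _ => measurable_lintegral_section lam (hT t)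
    _ = _ := Finset.sum_congr rfl fun t _ =>
        lintegral_lintegral_swap ((hT t).comp measurable_swap).aemeasurable

theorem lintegral_mul_prod_kap [SigmaFinite lam] [IsProbabilityMeasure μ] (hc : Measurable c)
    (hG : GNZ lam μ c) (hA : IsMax lam μ c A) (s : Finset ι)
    {u : ι → E × Measure E → ENNReal} (hu : ∀ i, Measurable (u i))
    {F : Measure E → ENNReal} (hF : Measurable F) :
    ∫⁻ ξ, F ξ * ∏ i ∈ s, ∫⁻ x, u i (x, ξ) ∂(kap lam c A ξ) ∂μ =
      ∑ P : Finpartition s, ∫⁻ ξ, insertion lam c u P.parts.toList F ξ ∂μ := by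
  induction s using Finset.strongInduction generalizing u F with
  | H s ih =>
    rcases s.eq_empty_or_nonempty with rfl | ⟨a, has⟩
    · have hP : ∀ P : Finpartition (∅ : Finset ι), P.parts = ∅ := fun P =>
        Finset.eq_empty_of_forall_notMem fun B hB =>
          P.ne_bot hB (Finset.subset_empty.1 (P.le hB))
      have hu1 : (Finset.univ : Finset (Finpartition (∅ : Finset ι))) = {⊥} := by
        ext P
        refine ⟨fun _ => Finset.mem_singleton.2 ?_, fun _ => Finset.mem_univ _⟩
        ext1
        rw [hP, hP]
      rw [hu1, Finset.sum_singleton, hP]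
      simp [insertion]
    · obtain ⟨s, ha, rfl⟩ : ∃ s', a ∉ s' ∧ s = insert a s' :=
        ⟨s.erase a, Finset.notMem_erase _ _, (Finset.insert_erase has).symm⟩
      rw [lintegral_mul_prod_kap_insert hc hG hA ha hu hF,
        ← sum_finpartition_insert ha fun S => ∫⁻ ξ, insertion lam c u S.toList F ξ ∂μ]
      refine Finset.sum_congr rfl fun t ht => ?_
      have hd : Measurable fun p : E × Measure E => p.2 + Measure.dirac p.1 :=
        measurable_add_dirac measurable_fst measurable_snd
      let u' : E → ι → E × Measure E → ENNReal := fun x i p => u i (p.1, p.2 + Measure.dirac x)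
      let F' : E → Measure E → ENNReal := fun x ξ => F (ξ + Measure.dirac x) *
        (∏ i ∈ insert a t, u i (x, ξ + Measure.dirac x)) * c (x, ξ)
      have hu' : ∀ i, Measurable fun q : E × E × Measure E => u' q.1 i q.2 := fun i =>
        (hu i).comp ((measurable_fst.comp measurable_snd).prodMk
          (hd.comp (measurable_fst.prodMk (measurable_snd.comp measurable_snd))))
      have hF' : Measurable fun q : E × Measure E => F' q.1 q.2 :=
        ((hF.comp hd).mul (Finset.measurable_fun_prod _ fun i _ =>
          (hu i).comp (measurable_fst.prodMk hd))).mul hc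
      have hlt : s \ t ⊂ insert a s :=
        (Finset.ssubset_insert ha).trans_le' Finset.sdiff_subset
      have hN : ∀ L : List (Finset ι), Measurable fun p : E × Measure E =>
          insertion lam c (u' p.1) L (F' p.1) p.2 := fun L =>
        measurable_insertion (α := E × Measure E) (u := fun p => u' p.1) (F := fun p => F' p.1)
          (g := Prod.snd) hc L
          (fun i => (hu' i).comp ((measurable_fst.comp measurable_fst).prodMk measurable_snd))
          (hF'.comp ((measurable_fst.comp measurable_fst).prodMk measurable_snd)) measurable_snd
      calc _ = ∫⁻ x, ∑ P : Finpartition (s \ t),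
            ∫⁻ ξ, insertion lam c (u' x) P.parts.toList (F' x) ξ ∂μ ∂lam :=
          lintegral_congr fun x => ih (s \ t) hlt (u := u' x) (F := F' x)
            (fun i => (hu' i).comp measurable_prodMk_left) (hF'.comp measurable_prodMk_left)
        _ = ∑ P : Finpartition (s \ t), ∫⁻ x,
            ∫⁻ ξ, insertion lam c (u' x) P.parts.toList (F' x) ξ ∂μ ∂lam :=
          lintegral_finsetSum _ fun P _ => (hN _).lintegral_prod_right'
        _ = _ := by
          refine Finset.sum_congr rfl fun P _ => ?_
          rw [lintegral_lintegral_swap (hN _).aemeasurable]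
          have hB : insert a t ∉ P.parts := fun h =>
            ha (Finset.mem_sdiff.1 (P.le h (Finset.mem_insert_self a t))).1
          refine lintegral_congr_ae ?_
          filter_upwards [insertion_perm hc hG hu ((List.perm_append_singleton _ _).trans
            (Finset.toList_insert hB).symm)] with ξ hξ
          rw [← hξ F hF]
          exact lintegral_insertion_eq_append hc hu (insert a t) P.parts.toList hF ξ

end

section

theorem chat_cons {E : Type*} [MeasurableSpace E] (c : E → Measure E → ENNReal) {k : ℕ} (a : E)
    (x : Fin k → E) (ξ : Measure E) :
    chat c (Fin.cons a x : Fin (k + 1) → E) ξ = c a ξ * chat c x (ξ + Measure.dirac a) := by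
  simp only [chat, Finset.sum_filter]
  rw [Fin.prod_univ_succ]
  simp [Fin.sum_univ_succ, add_assoc]

universe u₀
variable {E : Type u₀} [MeasurableSpace E] {lam : Measure E} {c : E → Measure E → ENNReal}
variable {ι : Type*}

theorem measurable_add_sum_dirac {α : Type*} [MeasurableSpace α] {g : α → Measure E}
    (hg : Measurable g) {κ : Type*} (s : Finset κ) {x : κ → α → E} (hx : ∀ l, Measurable (x l)) :
    Measurable fun a => g a + ∑ l ∈ s, Measure.dirac (x l a) := by
  classical
  induction s using Finset.induction_on with
  | empty => simpa using hg
  | insert l s hl ih =>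
    have h := measurable_add_dirac (hx l) ih
    simp only [Finset.sum_insert hl]
    convert h using 2
    rw [add_comm (Measure.dirac _), add_assoc]

theorem measurable_chat (hc : Measurable (Function.uncurry c)) {k : ℕ} (ξ : Measure E) :
    Measurable fun x : Fin k → E => chat c x ξ :=
  Finset.measurable_fun_prod _ fun l _ => hc.comp ((measurable_pi_apply l).prodMk
    (measurable_add_sum_dirac measurable_const _ measurable_pi_apply))

theorem lintegral_pi_eq_insertion [SigmaFinite lam] (hc : Measurable (Function.uncurry c))
    {u : ι → E × Measure E → ENNReal} (hu : ∀ i, Measurable (u i)) {k : ℕ} (b : Fin k → Finset ι)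
    {F : Measure E → ENNReal} (hF : Measurable F) (ξ : Measure E) :
    ∫⁻ x : Fin k → E, F (ξ + ∑ l, Measure.dirac (x l)) *
      (∏ l, ∏ i ∈ b l, u i (x l, ξ + ∑ l', Measure.dirac (x l'))) * chat c x ξ
      ∂(Measure.pi fun _ => lam) =
    insertion lam (Function.uncurry c) u (List.ofFn b) F ξ := by
  induction k generalizing F ξ with
  | zero =>
    rw [lintegral_unique]
    simp [insertion, chat]
  | succ k ih =>
    have hm : ∀ {k : ℕ} (b : Fin k → Finset ι) {F : Measure E → ENNReal}, Measurable F →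
        ∀ ξ, Measurable fun x : Fin k → E => F (ξ + ∑ l, Measure.dirac (x l)) *
          (∏ l, ∏ i ∈ b l, u i (x l, ξ + ∑ l', Measure.dirac (x l'))) * chat c x ξ := by
      intro k b F hF ξ
      have hs : Measurable fun x : Fin k → E => ξ + ∑ l, Measure.dirac (x l) :=
        measurable_add_sum_dirac measurable_const _ measurable_pi_apply
      exact ((hF.comp hs).mul (Finset.measurable_fun_prod _ fun l _ =>
        Finset.measurable_fun_prod _ fun i _ =>
          (hu i).comp ((measurable_pi_apply l).prodMk hs))).mul (measurable_chat hc ξ)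
    have e := (measurePreserving_piFinSuccAbove (fun _ : Fin (k + 1) => lam) 0).symm
    rw [← e.lintegral_comp (hm b hF ξ), List.ofFn_succ]
    refine (lintegral_prod _ ((hm b hF ξ).comp e.measurable).aemeasurable).trans ?_
    refine lintegral_congr fun a => ?_
    have hFa : Measurable fun η => F η * ∏ i ∈ b 0, u i (a, η) :=
      hF.mul (Finset.measurable_fun_prod _ fun i _ => (hu i).comp measurable_prodMk_left)
    rw [← ih (fun l => b l.succ) hFa, ← lintegral_const_mul _ (hm _ hFa _)]
    refine lintegral_congr fun x => ?_
    rw [Function.comp_apply]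
    have hx : (MeasurableEquiv.piFinSuccAbove (fun _ : Fin (k + 1) => E) 0).symm (a, x) =
        (Fin.cons a x : Fin (k + 1) → E) := by
      ext j
      refine Fin.cases ?_ (fun j => ?_) j <;> simp [MeasurableEquiv.piFinSuccAbove]
    rw [hx, chat_cons, Fin.prod_univ_succ]
    simp only [Fin.sum_univ_succ, Fin.cons_zero, Fin.cons_succ, add_assoc, Function.uncurry]
    ring

theorem ofFn_blockOf_perm {n : ℕ} (P : Finpartition (Finset.univ : Finset (Fin n))) :
    (List.ofFn (blockOf P)).Perm P.parts.toList := by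
  have hinj : Function.Injective (blockOf P) :=
    Subtype.val_injective.comp P.parts.equivFin.symm.injective
  rw [List.perm_ext_iff_of_nodup (List.nodup_ofFn.2 hinj) (Finset.nodup_toList _)]
  intro B
  rw [List.mem_ofFn, Finset.mem_toList]
  constructor
  · rintro ⟨l, rfl⟩
    exact (P.parts.equivFin.symm l).2
  · intro hB
    exact ⟨P.parts.equivFin ⟨B, hB⟩, by simp [blockOf]⟩

end

end Papangelou

/-- Extended moment formula (Theorem 3.2): for a point process `μ` with Papangelou
intensity `c` (GNZ identity), for all measurable `u_1, …, u_n : E × X → [0,∞]` and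
measurable `F : X → [0,∞]`,
`∫ F(ξ) ∏_k ∫ u_k(y,ξ) ξ(dy) μ(dξ)
  = ∑_{k=1}^n ∑_{𝒫 ∈ 𝒯_n^k} ∫_X ∫_{E^k} F(ξ+Δ) ∏_l ∏_{i∈P_l} u_i(x_l,ξ+Δ) ĉ(x,ξ) λ^k(dx) μ(dξ)`. -/
theorem moment_formula_general
    {E : Type*} [MeasurableSpace E] (lam : Measure E) [SigmaFinite lam]
    (μ : Measure (Measure E)) [IsProbabilityMeasure μ]
    (c : E → Measure E → ENNReal) (hc : Measurable (Function.uncurry c))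
    (hGNZ : ∀ w : E → Measure E → ENNReal, Measurable (Function.uncurry w) →
      ∫⁻ ξ, (∫⁻ x, w x ξ ∂ξ) ∂μ
        = ∫⁻ ξ, ∫⁻ x, w x (ξ + Measure.dirac x) * c x ξ ∂lam ∂μ)
    (n : ℕ) (hn : 1 ≤ n)
    (u : Fin n → E → Measure E → ENNReal)
    (hu : ∀ i, Measurable (Function.uncurry (u i)))
    (F : Measure E → ENNReal) (hF : Measurable F) :
    ∫⁻ ξ, F ξ * ∏ i : Fin n, (∫⁻ y, u i y ξ ∂ξ) ∂μ =
      ∑ k ∈ Finset.Icc 1 n,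
        ∑ P ∈ Finset.univ.filter
            (fun P : Finpartition (Finset.univ : Finset (Fin n)) => P.parts.card = k),
          ∫⁻ ξ, ∫⁻ x : Fin P.parts.card → E,
            F (ξ + ∑ l, Measure.dirac (x l)) *
              (∏ l : Fin P.parts.card, ∏ i ∈ blockOf P l,
                u i (x l) (ξ + ∑ l', Measure.dirac (x l'))) *
              chat c x ξ
            ∂(Measure.pi fun _ => lam) ∂μ := by
  have hG : Papangelou.GNZ lam μ (Function.uncurry c) := fun w hw => hGNZ (Function.curry w) hw
  obtain ⟨A, hA⟩ := Papangelou.exists_isMax lam μ hc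
  have hcard : ∀ P ∈ (Finset.univ : Finset (Finpartition (Finset.univ : Finset (Fin n)))),
      P.parts.card ∈ Finset.Icc 1 n := by
    intro P _
    have hne : (Finset.univ : Finset (Fin n)) ≠ ⊥ :=
      Finset.nonempty_iff_ne_empty.1 ⟨⟨0, hn⟩, Finset.mem_univ _⟩
    refine Finset.mem_Icc.2 ⟨Finset.card_pos.2 (P.parts_nonempty hne), ?_⟩
    simpa using P.card_parts_le_card
  rw [Finset.sum_fiberwise_of_maps_to hcard]
  refine (Papangelou.lintegral_mul_prod_eq_kap (u := fun i => Function.uncurry (u i))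
    hc hG hA Finset.univ hu hF).trans ?_
  rw [Papangelou.lintegral_mul_prod_kap hc hG hA Finset.univ hu hF]
  refine Finset.sum_congr (by congr!) fun P _ => lintegral_congr_ae ?_
  filter_upwards [Papangelou.insertion_perm hc hG hu (Papangelou.ofFn_blockOf_perm P)] with ξ hξ
  rw [← hξ F hF]
  exact (Papangelou.lintegral_pi_eq_insertion hc hu (blockOf P) hF ξ).symm
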